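/- arXiv:2507.03889 — 2 statements merged into one kernel-verified Lean document; each statement's English description precedes it below -/
import Mathlib

section
/- Let G be a graph on [n] whose binomial edge ideal has maximal projective dimension, i.e., pd(S/J_G) = 2n - 4. Then bigheight(J_G) = 2n - 4 as well. -/
open SimpleGraph

/-- The binomial edge ideal of a graph `G`, in the polynomial ring over `K` with variables
`x_i = X (Sum.inl i)` and `y_i = X (Sum.inr i)`. -/
noncomputable def binomialEdgeIdeal (K : Type) [Field K] {V : Type} (G : SimpleGraph V) :
    Ideal (MvPolynomial (V ⊕ V) K) :=
  Ideal.span { f | ∃ i j, G.Adj i j ∧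
    f = MvPolynomial.X (Sum.inl i) * MvPolynomial.X (Sum.inr j)
      - MvPolynomial.X (Sum.inl j) * MvPolynomial.X (Sum.inr i) }

/-- The height of an ideal: the least height of a minimal prime over it. -/
noncomputable def idealHeight {R : Type*} [CommRing R] (I : Ideal R) : ℕ∞ :=
  sInf { h | ∃ p : PrimeSpectrum R, p.asIdeal ∈ I.minimalPrimes ∧ h = Order.height p }

/-- The big height of an ideal: the largest height of a minimal prime over it. -/
noncomputable def bigHeight {R : Type*} [CommRing R] (I : Ideal R) : ℕ∞ :=
  sSup { h | ∃ p : PrimeSpectrum R, p.asIdeal ∈ I.minimalPrimes ∧ h = Order.height p }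

open CategoryTheory in
/-- The projective dimension of a module `M`, characterized via vanishing of `Ext`:
`projDim R M ≤ n` iff `Ext^k (M, N) = 0` for all `N` and all `k > n`. -/
noncomputable def projDim (R : Type) [CommRing R] (M : ModuleCat R) : ℕ∞ :=
  sInf { n : ℕ∞ | ∀ (N : ModuleCat R) (k : ℕ), n < (k : ℕ∞) →
    Subsingleton (((Ext R (ModuleCat R) k).obj (Opposite.op M)).obj N) }

section
open CategoryTheory Abelian

theorem exactAt_linearYonedaObj_iff {R : Type} [CommRing R] {M : ModuleCat.{0} R}
    (P : ProjectiveResolution M) (N : ModuleCat.{0} R) (p : ℕ) :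
    (P.complex.linearYonedaObj R N).ExactAt (p + 1) ↔
      Subsingleton (Abelian.Ext M N (p + 1)) := by
  rw [HomologicalComplex.exactAt_iff' _ p (p + 1) (p + 2) (by simp) (by simp),
    ShortComplex.moduleCat_exact_iff]
  constructor
  · intro h
    refine ⟨fun a b => ?_⟩
    suffices H : ∀ a : Abelian.Ext M N (p + 1), a = 0 by rw [H a, H b]
    intro a
    obtain ⟨f, hf, rfl⟩ := P.extMk_surjective a (p + 2) rfl
    rw [P.extMk_eq_zero_iff f (p + 2) rfl hf p rfl]
    exact h f hf
  · intro h f hf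
    have := Subsingleton.elim (P.extMk f (p + 2) rfl hf) 0
    rw [P.extMk_eq_zero_iff f (p + 2) rfl hf p rfl] at this
    exact this

theorem subsingleton_ext_iff {R : Type} [CommRing R] (M N : ModuleCat.{0} R) (p : ℕ) :
    Subsingleton (((Ext R (ModuleCat.{0} R) (p + 1)).obj (Opposite.op M)).obj N) ↔
      Subsingleton (Abelian.Ext M N (p + 1)) := by
  rw [← exactAt_linearYonedaObj_iff (projectiveResolution M) N p,
    HomologicalComplex.exactAt_iff_isZero_homology,
    ← ((projectiveResolution M).isoExt (R := R) (p + 1) N).isZero_iff]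
  rw [ModuleCat.isZero_iff_subsingleton]
end

section ProjectiveDimension
open CategoryTheory

/-- The `R`-module `M` has projective dimension at most `d`. -/
def PdLE (R : Type) [CommRing R] (M : Type) [AddCommGroup M] [Module R M] (d : ℕ) : Prop :=
  HasProjectiveDimensionLE (ModuleCat.of R M) d

namespace PdLE

variable {R : Type} [CommRing R] {A B C : Type} [AddCommGroup A] [Module R A]
  [AddCommGroup B] [Module R B] [AddCommGroup C] [Module R C]

theorem mono {d e : ℕ} (h : PdLE R A d) (hde : d ≤ e) : PdLE R A e :=
  have : HasProjectiveDimensionLT (ModuleCat.of R A) (d + 1) := h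
  hasProjectiveDimensionLT_of_ge _ (d + 1) (e + 1) (by lia)

theorem of_equiv (e : A ≃ₗ[R] B) {d : ℕ} (h : PdLE R A d) : PdLE R B d :=
  have : HasProjectiveDimensionLT (ModuleCat.of R A) (d + 1) := h
  hasProjectiveDimensionLT_of_iso e.toModuleIso (d + 1)

theorem of_projective [Module.Projective R A] : PdLE R A 0 := by
  have : Projective (ModuleCat.of R A) := (IsProjective.iff_projective A).1 inferInstance
  exact (projective_iff_hasProjectiveDimensionLE_zero _).1 this

variable {f : A →ₗ[R] B} {g : B →ₗ[R] C}

theorem shortExact (hf : Function.Injective f) (hfg : Function.Exact f g)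
    (hg : Function.Surjective g) :
    (ShortComplex.moduleCatMk f g hfg.linearMap_comp_eq_zero).ShortExact where
  exact := by
    rw [ShortComplex.moduleCat_exact_iff]
    intro x hx
    exact (hfg x).1 hx
  mono_f := (ModuleCat.mono_iff_injective _).2 hf
  epi_g := (ModuleCat.epi_iff_surjective _).2 hg

theorem middle (hf : Function.Injective f) (hfg : Function.Exact f g)
    (hg : Function.Surjective g) {d : ℕ} (hA : PdLE R A d) (hC : PdLE R C d) : PdLE R B d :=
  (shortExact hf hfg hg).hasProjectiveDimensionLT_X₂ (d + 1) hA hC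

theorem right (hf : Function.Injective f) (hfg : Function.Exact f g)
    (hg : Function.Surjective g) {d : ℕ} (hA : PdLE R A d) (hB : PdLE R B (d + 1)) :
    PdLE R C (d + 1) :=
  (shortExact hf hfg hg).hasProjectiveDimensionLT_X₃ (d + 1) hA hB

theorem left (hf : Function.Injective f) (hfg : Function.Exact f g)
    (hg : Function.Surjective g) {d : ℕ} (hB : PdLE R B d) (hC : PdLE R C (d + 1)) :
    PdLE R A d :=
  (shortExact hf hfg hg).hasProjectiveDimensionLT_X₁ (d + 1) hB hC

theorem prod {d : ℕ} (hA : PdLE R A d) (hB : PdLE R B d) : PdLE R (A × B) d :=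
  middle (f := LinearMap.inl R A B) (g := LinearMap.snd R A B) LinearMap.inl_injective
    Function.Exact.inl_snd LinearMap.snd_surjective hA hB

end PdLE

variable {R : Type} [CommRing R]

/-- A Mayer–Vietoris bound. -/
theorem pdLE_quotient_inf (I J : Ideal R) {d : ℕ} (hI : PdLE R (R ⧸ I) d)
    (hJ : PdLE R (R ⧸ J) d) (hIJ : PdLE R (R ⧸ (I ⊔ J)) (d + 1)) :
    PdLE R (R ⧸ (I ⊓ J)) d := by
  refine PdLE.left
    (f := (Submodule.factor (inf_le_left : I ⊓ J ≤ I)).prod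
      (Submodule.factor (inf_le_right : I ⊓ J ≤ J)))
    (g := (Submodule.factor (le_sup_left : I ≤ I ⊔ J)).coprod
      (-Submodule.factor (le_sup_right : J ≤ I ⊔ J))) ?_ ?_ ?_ (hI.prod hJ) hIJ
  · rw [← LinearMap.ker_eq_bot, LinearMap.ker_eq_bot']
    intro m hm
    obtain ⟨m, rfl⟩ := Submodule.Quotient.mk_surjective _ m
    obtain ⟨hm₁, hm₂⟩ := Prod.ext_iff.1 hm
    exact (Submodule.Quotient.mk_eq_zero _).2
      ⟨(Submodule.Quotient.mk_eq_zero _).1 hm₁, (Submodule.Quotient.mk_eq_zero _).1 hm₂⟩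
  · rintro ⟨a, b⟩
    obtain ⟨a, rfl⟩ := Submodule.Quotient.mk_surjective _ a
    obtain ⟨b, rfl⟩ := Submodule.Quotient.mk_surjective _ b
    constructor
    · intro h
      have h' : (Submodule.Quotient.mk (a - b) : R ⧸ (I ⊔ J)) = 0 := by
        rw [sub_eq_add_neg]
        exact h
      obtain ⟨u, hu, v, hv, huv⟩ := Submodule.mem_sup.1 ((Submodule.Quotient.mk_eq_zero _).1 h')
      refine ⟨Submodule.Quotient.mk (a - u), Prod.ext ?_ ?_⟩
      · refine (Submodule.Quotient.eq _).2 ?_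
        simpa using I.neg_mem hu
      · refine (Submodule.Quotient.eq _).2 ?_
        have : a - u - b = v := by linear_combination -huv
        change a - u - b ∈ J
        rw [this]
        exact hv
    · rintro ⟨x, hx⟩
      obtain ⟨x, rfl⟩ := Submodule.Quotient.mk_surjective _ x
      rw [← hx]
      exact add_neg_cancel (Submodule.Quotient.mk x : R ⧸ (I ⊔ J))
  · intro c
    obtain ⟨c, rfl⟩ := Submodule.Quotient.mk_surjective _ c
    exact ⟨(Submodule.Quotient.mk c, 0), by simp⟩

theorem exact_subtype_factor {I J : Ideal R} (h : I ≤ J) :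
    Function.Exact (Submodule.map I.mkQ J).subtype (Submodule.factor h) := by
  intro x
  obtain ⟨x, rfl⟩ := Submodule.Quotient.mk_surjective _ x
  rw [Submodule.coe_subtype, Subtype.range_coe]
  constructor
  · intro hx
    exact ⟨x, (Submodule.Quotient.mk_eq_zero _).1 hx, rfl⟩
  · rintro ⟨y, hy, hyx⟩
    refine (Submodule.Quotient.mk_eq_zero _).2 ?_
    have : y - x ∈ I := (Submodule.Quotient.eq _).1 hyx
    have := J.sub_mem hy (h this)
    simpa using this

/-- If the families `p` and `q` are proportional modulo the prime `I`, then adjoining `q` to `I`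
is controlled by adjoining `p`, as the two ideals of `R ⧸ I` they generate are isomorphic. -/
theorem pdLE_quotient_of_proportional {I : Ideal R} (hI : I.IsPrime) {ι : Type} (p q : ι → R)
    (i₀ : ι) (hp : p i₀ ∉ I) (hq : q i₀ ∉ I) (hpq : ∀ i, p i₀ * q i - q i₀ * p i ∈ I) {d : ℕ}
    (h : PdLE R (R ⧸ I) d) (h' : PdLE R (R ⧸ (I ⊔ Ideal.span (Set.range p))) (d + 1)) :
    PdLE R (R ⧸ (I ⊔ Ideal.span (Set.range q))) (d + 1) := by
  have key : ∀ r : ι → R, Submodule.map I.mkQ (I ⊔ Ideal.span (Set.range r)) =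
      Submodule.span R (Set.range fun i => I.mkQ (r i)) := by
    intro r
    rw [Submodule.map_sup, Submodule.mkQ_map_self, bot_sup_eq, Ideal.span, Submodule.map_span,
      ← Set.range_comp]
    rfl
  have inj : ∀ r ∉ I, Function.Injective (LinearMap.lsmul R (R ⧸ I) r) := by
    intro r hr
    rw [← LinearMap.ker_eq_bot, LinearMap.ker_eq_bot']
    intro m hm
    obtain ⟨m, rfl⟩ := Submodule.Quotient.mk_surjective _ m
    have : r * m ∈ I := (Submodule.Quotient.mk_eq_zero _).1 hm
    exact (Submodule.Quotient.mk_eq_zero _).2 ((hI.mem_or_mem this).resolve_left hr)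
  have hX : PdLE R (Submodule.map I.mkQ (I ⊔ Ideal.span (Set.range p))) d :=
    PdLE.left (Submodule.subtype_injective _) (exact_subtype_factor le_sup_left)
      (Submodule.factor_surjective _) h h'
  have hmap : (Submodule.map I.mkQ (I ⊔ Ideal.span (Set.range p))).map
        (LinearMap.lsmul R (R ⧸ I) (q i₀)) =
      (Submodule.map I.mkQ (I ⊔ Ideal.span (Set.range q))).map
        (LinearMap.lsmul R (R ⧸ I) (p i₀)) := by
    rw [key, key, Submodule.map_span, Submodule.map_span, ← Set.range_comp, ← Set.range_comp]
    congr 2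
    funext i
    refine (Submodule.Quotient.eq _).2 ?_
    have := I.neg_mem (hpq i)
    rwa [neg_sub] at this
  have e₁ := Submodule.equivMapOfInjective _ (inj _ hq)
    (Submodule.map I.mkQ (I ⊔ Ideal.span (Set.range p)))
  have e₂ := Submodule.equivMapOfInjective _ (inj _ hp)
    (Submodule.map I.mkQ (I ⊔ Ideal.span (Set.range q)))
  have e := e₁.trans ((LinearEquiv.ofEq _ _ hmap).trans e₂.symm)
  have hX' := hX.of_equiv e
  exact PdLE.right (f := (Submodule.map I.mkQ (I ⊔ Ideal.span (Set.range q))).subtype)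
    (g := Submodule.factor (le_sup_left : I ≤ I ⊔ Ideal.span (Set.range q)))
    (Submodule.subtype_injective _) (exact_subtype_factor le_sup_left)
    (Submodule.factor_surjective _) hX' (h.mono d.le_succ)

/-- Adjoining one element to a prime raises the projective dimension of the quotient by at most
one. -/
theorem pdLE_quotient_sup_span_singleton {I : Ideal R} (hI : I.IsPrime) (x : R) {d : ℕ}
    (h : PdLE R (R ⧸ I) d) : PdLE R (R ⧸ (I ⊔ Ideal.span {x})) (d + 1) := by
  by_cases hx : x ∈ I
  · have : I ⊔ Ideal.span {x} = I := by
      rw [sup_eq_left, Ideal.span_singleton_le_iff_mem]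
      exact hx
    rw [this]
    exact h.mono d.le_succ
  have hzero : PdLE R (R ⧸ (I ⊔ Ideal.span (Set.range fun _ : Unit => (1 : R)))) (d + 1) := by
    have : I ⊔ Ideal.span (Set.range fun _ : Unit => (1 : R)) = ⊤ := by simp
    rw [this]
    have : Subsingleton (R ⧸ (⊤ : Ideal R)) := Ideal.Quotient.subsingleton_iff.2 rfl
    exact PdLE.of_projective.mono (Nat.zero_le _)
  have := pdLE_quotient_of_proportional hI (fun _ : Unit => 1) (fun _ : Unit => x) ()
    ((Ideal.ne_top_iff_one I).1 hI.ne_top) hx (by simp) h hzero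
  rwa [Set.range_const] at this

end ProjectiveDimension

section CliqueIdeal
open MvPolynomial

variable (K : Type) [Field K] {V : Type}

/-- The `2 × 2` minor `x_i y_j - x_j y_i`. -/
noncomputable def minor (i j : V) : MvPolynomial (V ⊕ V) K :=
  X (Sum.inl i) * X (Sum.inr j) - X (Sum.inl j) * X (Sum.inr i)

/-- The ideal generated by the minors on pairs of vertices in the same fibre of `c`. -/
noncomputable def cliqueIdeal (c : V → V) : Ideal (MvPolynomial (V ⊕ V) K) :=
  Ideal.span { f | ∃ i j, c i = c j ∧ f = minor K i j }

/-- The exponent of the image of a variable under `toricMap`. -/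
noncomputable def toricExponent (c : V → V) : V ⊕ V → (V ⊕ V ⊕ V →₀ ℕ) :=
  Sum.elim
    (fun v => Finsupp.single (Sum.inl (c v)) 1 + Finsupp.single (Sum.inr (Sum.inr v)) 1)
    (fun v => Finsupp.single (Sum.inr (Sum.inl (c v))) 1 +
      Finsupp.single (Sum.inr (Sum.inr v)) 1)

/-- The map `x_v ↦ s_{c v} t_v`, `y_v ↦ u_{c v} t_v`. -/
noncomputable def toricMap (c : V → V) :
    MvPolynomial (V ⊕ V) K →ₐ[K] MvPolynomial (V ⊕ V ⊕ V) K :=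
  aeval fun z => monomial (toricExponent c z) 1

/-- The substitution sending the variables in `Z` to zero. -/
noncomputable def killMap {σ : Type} (Z : Set σ) [DecidablePred (· ∈ Z)] :
    MvPolynomial σ K →ₐ[K] MvPolynomial σ K :=
  aeval fun z => if z ∈ Z then 0 else X z

variable {K}

theorem sub_killMap_mem {σ : Type} (Z : Set σ) [DecidablePred (· ∈ Z)] (g : MvPolynomial σ K) :
    g - killMap K Z g ∈ Ideal.span ((X : σ → MvPolynomial σ K) '' Z) := by
  have : (Ideal.Quotient.mkₐ K (Ideal.span ((X : σ → MvPolynomial σ K) '' Z))).comp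
      (killMap K Z) = Ideal.Quotient.mkₐ K _ := by
    ext z
    simp only [AlgHom.comp_apply, killMap, aeval_X, Ideal.Quotient.mkₐ_eq_mk]
    split_ifs with h
    · rw [map_zero, eq_comm, Ideal.Quotient.eq_zero_iff_mem]
      exact Ideal.subset_span ⟨z, h, rfl⟩
    · rfl
  exact Ideal.Quotient.eq.1 (DFunLike.congr_fun this g).symm

@[simp] theorem minor_self (i : V) : minor K i i = 0 := sub_self _

theorem toricMap_X (c : V → V) (z : V ⊕ V) :
    toricMap K c (X z) = monomial (toricExponent c z) 1 := aeval_X _ _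

theorem toricMap_minor {c : V → V} {i j : V} (h : c i = c j) :
    toricMap K c (minor K i j) = 0 := by
  simp only [minor, map_sub, map_mul, toricMap_X, monomial_mul, toricExponent, Sum.elim_inl,
    Sum.elim_inr, h]
  rw [sub_eq_zero]
  congr 2
  abel

variable [Fintype V]

theorem toricMap_monomial (c : V → V) (m : V ⊕ V →₀ ℕ) (a : K) :
    toricMap K c (monomial m a) = monomial (∑ z, m z • toricExponent c z) a := by
  rw [monomial_sum_index, monomial_eq, Finsupp.prod_fintype _ _ (by simp), map_mul, map_prod]
  congr 1
  · exact (toricMap K c).commutes a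
  · simp only [map_pow, toricMap_X, monomial_pow, one_pow]

variable [DecidableEq V]

theorem toricExponent_sum_inl (c : V → V) (m : V ⊕ V →₀ ℕ) (r : V) :
    (∑ z, m z • toricExponent c z) (Sum.inl r) = ∑ v with c v = r, m (Sum.inl v) := by
  simp [toricExponent, Finsupp.single_apply, Finset.sum_filter]

theorem toricExponent_sum_inr (c : V → V) (m : V ⊕ V →₀ ℕ) (v : V) :
    (∑ z, m z • toricExponent c z) (Sum.inr (Sum.inr v)) =
      m (Sum.inl v) + m (Sum.inr v) := by
  simp [toricExponent, Finsupp.single_apply]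

theorem monomial_sub_monomial_mem_cliqueIdeal (c : V → V) (m m' : V ⊕ V →₀ ℕ)
    (h : ∑ z, m z • toricExponent c z = ∑ z, m' z • toricExponent c z) :
    monomial m (1 : K) - monomial m' 1 ∈ cliqueIdeal K c := by
  obtain ⟨D, hD⟩ : ∃ D, ∑ v, (m (Sum.inl v) - m' (Sum.inl v)) = D := ⟨_, rfl⟩
  induction D using Nat.strong_induction_on generalizing m with | _ D ih
  have hinl : ∀ r, ∑ v with c v = r, m (Sum.inl v) = ∑ v with c v = r, m' (Sum.inl v) :=
    fun r => by rw [← toricExponent_sum_inl, h, toricExponent_sum_inl]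
  have hinr : ∀ v, m (Sum.inl v) + m (Sum.inr v) = m' (Sum.inl v) + m' (Sum.inr v) :=
    fun v => by rw [← toricExponent_sum_inr c, h, toricExponent_sum_inr]
  by_cases hle : ∀ v, m (Sum.inl v) ≤ m' (Sum.inl v)
  · have heq : m = m' := by
      have hl : ∀ v, m (Sum.inl v) = m' (Sum.inl v) := fun v =>
        (Finset.sum_eq_sum_iff_of_le fun w _ => hle w).1 (hinl (c v)) v (by simp)
      ext (v | v)
      · exact hl v
      · have := hinr v
        have := hl v
        omega
    rw [heq, sub_self]
    exact zero_mem _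
  push Not at hle
  obtain ⟨i, hi⟩ := hle
  obtain ⟨j, hj, hji⟩ : ∃ j, m (Sum.inl j) < m' (Sum.inl j) ∧ c j = c i := by
    by_contra! hcon
    refine (Finset.sum_lt_sum (s := {v | c v = c i}) (f := fun v => m' (Sum.inl v))
      (g := fun v => m (Sum.inl v)) (fun v hv => ?_) ⟨i, by simp, hi⟩).ne' (hinl (c i))
    by_contra! hlt
    exact hcon v hlt (by simpa using hv)
  have hij : i ≠ j := by
    rintro rfl
    omega
  have hj' : 0 < m (Sum.inr j) := by
    have := hinr j
    omega
  obtain ⟨n, rfl⟩ : ∃ n, m = n + (Finsupp.single (Sum.inl i) 1 + Finsupp.single (Sum.inr j) 1) := by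
    refine ⟨m - (Finsupp.single (Sum.inl i) 1 + Finsupp.single (Sum.inr j) 1),
      (tsub_add_cancel_of_le ?_).symm⟩
    intro z
    simp only [Finsupp.add_apply, Finsupp.single_apply]
    rcases z with z | z
    · by_cases h : i = z
      · subst h
        simp
        omega
      · simp [h]
    · by_cases h : j = z
      · subst h
        simp
        omega
      · simp [h]
  have hexp : toricExponent c (Sum.inl i) + toricExponent c (Sum.inr j) =
      toricExponent c (Sum.inl j) + toricExponent c (Sum.inr i) := by
    simp only [toricExponent, Sum.elim_inl, Sum.elim_inr, hji]
    abel
  have hsum : ∀ (n : V ⊕ V →₀ ℕ) (z w : V ⊕ V),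
      ∑ x, (n + (Finsupp.single z 1 + Finsupp.single w 1) : V ⊕ V →₀ ℕ) x • toricExponent c x =
      ∑ x, n x • toricExponent c x + (toricExponent c z + toricExponent c w) := by
    intro n z w
    simp only [Finsupp.add_apply, add_smul, Finset.sum_add_distrib, Finsupp.single_apply,
      ite_smul, one_smul, zero_smul, Finset.sum_ite_eq, Finset.mem_univ, if_true]
  have hrec := ih _ ?_
    (n + (Finsupp.single (Sum.inl j) 1 + Finsupp.single (Sum.inr i) 1)) ?_ rfl
  · have hstep :
        monomial (n + (Finsupp.single (Sum.inl i) 1 + Finsupp.single (Sum.inr j) 1)) (1 : K)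
        - monomial (n + (Finsupp.single (Sum.inl j) 1 + Finsupp.single (Sum.inr i) 1)) 1 =
        monomial n 1 * minor K i j := by
      simp only [minor, X, monomial_mul, mul_sub, mul_one]
    have hmem : monomial n 1 * minor K i j ∈ cliqueIdeal K c :=
      Ideal.mul_mem_left _ _ (Ideal.subset_span ⟨i, j, hji.symm, rfl⟩)
    rw [← hstep] at hmem
    simpa using add_mem hmem hrec
  · rw [← hD]
    refine Finset.sum_lt_sum (fun v _ => ?_) ⟨i, Finset.mem_univ _, ?_⟩
    · by_cases hv : j = v
      · subst hv
        simp [hij] at hj ⊢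
        omega
      · by_cases hv' : i = v
        · subst hv'
          simp [hv]
          omega
        · simp [hv, hv']
    · simp [hij.symm] at hi ⊢
      omega
  · rw [← h, hsum, hsum, hexp]

theorem ker_toricMap (c : V → V) : RingHom.ker (toricMap K c) = cliqueIdeal K c := by
  apply le_antisymm
  · intro g hg
    let θ : (V ⊕ V →₀ ℕ) → (V ⊕ V ⊕ V →₀ ℕ) := fun m => ∑ z, m z • toricExponent c z
    let L : MvPolynomial (V ⊕ V ⊕ V) K →ₗ[K] MvPolynomial (V ⊕ V) K :=
      (basisMonomials (V ⊕ V ⊕ V) K).constr K fun e => monomial (Function.invFun θ e) 1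
    have hL : ∀ e a, L (monomial e a) = monomial (Function.invFun θ e) a := by
      intro e a
      have h₁ : monomial e a = a • basisMonomials (V ⊕ V ⊕ V) K e := by
        simp [smul_monomial]
      rw [h₁, map_smul, Module.Basis.constr_basis, smul_monomial, smul_eq_mul, mul_one]
    have key : ∀ g, g - L (toricMap K c g) ∈ cliqueIdeal K c := by
      intro g
      induction g using MvPolynomial.induction_on' with
      | monomial m a =>
        rw [toricMap_monomial, hL]
        have hθ : θ (Function.invFun θ (θ m)) = θ m := Function.invFun_eq ⟨m, rfl⟩
        have := Ideal.mul_mem_left _ (C a)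
          (monomial_sub_monomial_mem_cliqueIdeal (K := K) c m _ hθ.symm)
        rwa [mul_sub, C_mul_monomial, C_mul_monomial, mul_one] at this
      | add p q hp hq =>
        have := add_mem hp hq
        rw [map_add, map_add]
        convert this using 1
        ring
    have := key g
    rwa [(RingHom.mem_ker).1 hg, map_zero, sub_zero] at this
  · rw [cliqueIdeal, Ideal.span_le]
    rintro _ ⟨i, j, hij, rfl⟩
    exact toricMap_minor hij

end CliqueIdeal

section CliqueUnion
open MvPolynomial

variable (K : Type) [Field K] {V : Type}

/-- The sum of `cliqueIdeal K c` and the ideal of the variables in `Z`. -/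
noncomputable def cliqueVarIdeal (c : V → V) (Z : Finset (V ⊕ V)) :
    Ideal (MvPolynomial (V ⊕ V) K) :=
  cliqueIdeal K c ⊔ Ideal.span (X '' (Z : Set (V ⊕ V)))

/-- Every variable in `Z` sits at a vertex that is alone in its fibre of `c`. -/
def IsolatedIn (c : V → V) (Z : Finset (V ⊕ V)) : Prop :=
  ∀ z ∈ Z, ∀ w, c w = c (Sum.elim id id z) → w = Sum.elim id id z

variable {K}

theorem X_mem_cliqueVarIdeal {c : V → V} {Z : Finset (V ⊕ V)} {z : V ⊕ V} (hz : z ∈ Z) :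
    X z ∈ cliqueVarIdeal K c Z :=
  Ideal.mem_sup_right (Ideal.subset_span ⟨z, hz, rfl⟩)

theorem minor_mem_cliqueVarIdeal {c : V → V} {Z : Finset (V ⊕ V)} {i j : V} (h : c i = c j) :
    minor K i j ∈ cliqueVarIdeal K c Z :=
  Ideal.mem_sup_left (Ideal.subset_span ⟨i, j, h, rfl⟩)

theorem cliqueVarIdeal_le {c : V → V} {Z : Finset (V ⊕ V)} {I : Ideal (MvPolynomial (V ⊕ V) K)}
    (h₁ : ∀ i j, c i = c j → minor K i j ∈ I) (h₂ : ∀ z ∈ Z, X z ∈ I) :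
    cliqueVarIdeal K c Z ≤ I := by
  refine sup_le (Ideal.span_le.2 ?_) (Ideal.span_le.2 ?_)
  · rintro _ ⟨i, j, h, rfl⟩
    exact h₁ i j h
  · rintro _ ⟨z, hz, rfl⟩
    exact h₂ z hz

theorem minor_swap (i j : V) : minor K j i = -minor K i j := by
  simp only [minor]
  ring

theorem killMap_X {σ : Type} (Z : Set σ) [DecidablePred (· ∈ Z)] (z : σ) :
    killMap K Z (X z) = if z ∈ Z then 0 else X z := aeval_X _ _

theorem killMap_minor (Z : Set (V ⊕ V)) [DecidablePred (· ∈ Z)] {i j : V}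
    (h₁ : Sum.inl i ∉ Z) (h₂ : Sum.inr i ∉ Z) (h₃ : Sum.inl j ∉ Z) (h₄ : Sum.inr j ∉ Z) :
    killMap K Z (minor K i j) = minor K i j := by
  simp [minor, killMap_X, h₁, h₂, h₃, h₄]

variable [Fintype V] [DecidableEq V]

theorem ker_toricMap_comp_killMap {c : V → V} {Z : Finset (V ⊕ V)} (h : IsolatedIn c Z) :
    RingHom.ker ((toricMap K c).comp (killMap K (Z : Set (V ⊕ V)))) = cliqueVarIdeal K c Z := by
  apply le_antisymm
  · intro g hg
    have h₁ : killMap K (Z : Set (V ⊕ V)) g ∈ cliqueIdeal K c := by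
      rw [← ker_toricMap]
      exact hg
    have := add_mem (Ideal.mem_sup_right (sub_killMap_mem (K := K) (Z : Set (V ⊕ V)) g))
      (Ideal.mem_sup_left h₁ : _ ∈ cliqueVarIdeal K c Z)
    rwa [sub_add_cancel] at this
  · refine cliqueVarIdeal_le (fun i j hij => ?_) (fun z hz => ?_)
    · rw [RingHom.mem_ker]
      rcases eq_or_ne i j with rfl | hne
      · simp
      · have h₁ : ∀ z ∈ Z, Sum.elim id id z ≠ i := by
          rintro z hz rfl
          exact hne (h z hz j hij.symm).symm
        have h₂ : ∀ z ∈ Z, Sum.elim id id z ≠ j := by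
          rintro z hz rfl
          exact hne (h z hz i hij)
        rw [AlgHom.comp_apply, killMap_minor, toricMap_minor hij]
        · exact fun hz => h₁ _ hz rfl
        · exact fun hz => h₁ _ hz rfl
        · exact fun hz => h₂ _ hz rfl
        · exact fun hz => h₂ _ hz rfl
    · rw [RingHom.mem_ker, AlgHom.comp_apply, killMap_X, if_pos (by exact_mod_cast hz), map_zero]

theorem isPrime_cliqueVarIdeal {c : V → V} {Z : Finset (V ⊕ V)} (h : IsolatedIn c Z) :
    (cliqueVarIdeal K c Z).IsPrime := by
  rw [← ker_toricMap_comp_killMap h]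
  exact RingHom.ker_isPrime _

theorem X_notMem_cliqueVarIdeal {c : V → V} {Z : Finset (V ⊕ V)} (h : IsolatedIn c Z)
    {z : V ⊕ V} (hz : z ∉ Z) : X z ∉ cliqueVarIdeal K c Z := by
  rw [← ker_toricMap_comp_killMap h, RingHom.mem_ker, AlgHom.comp_apply, killMap_X,
    if_neg (by exact_mod_cast hz), toricMap_X]
  simp

theorem minor_notMem_cliqueVarIdeal {c : V → V} {Z : Finset (V ⊕ V)} (h : IsolatedIn c Z)
    {i j : V} (hij : c i ≠ c j) (hi : ∀ z ∈ Z, Sum.elim id id z ≠ i)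
    (hj : ∀ z ∈ Z, Sum.elim id id z ≠ j) : minor K i j ∉ cliqueVarIdeal K c Z := by
  rw [← ker_toricMap_comp_killMap h, RingHom.mem_ker, AlgHom.comp_apply, killMap_minor]
  · simp only [minor, map_sub, map_mul, toricMap_X, monomial_mul, mul_one]
    intro h0
    rw [sub_eq_zero] at h0
    have h1 := MvPolynomial.monomial_left_injective (one_ne_zero' K) h0
    have := DFunLike.congr_fun h1 (Sum.inl (c i))
    simp [toricExponent, hij.symm] at this
  · exact fun hz => hi _ hz rfl
  · exact fun hz => hi _ hz rfl
  · exact fun hz => hj _ hz rfl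
  · exact fun hz => hj _ hz rfl

theorem pdLE_cliqueVarIdeal_of_id {c : V → V} (hc : ∀ v, c v = v) (Z : Finset (V ⊕ V)) :
    PdLE (MvPolynomial (V ⊕ V) K) (MvPolynomial (V ⊕ V) K ⧸ cliqueVarIdeal K c Z) Z.card := by
  induction Z using Finset.induction_on with
  | empty =>
    have h : cliqueVarIdeal K c ∅ = ⊥ := by
      refine le_bot_iff.1 (cliqueVarIdeal_le (fun i j hij => ?_) (by simp))
      rw [hc, hc] at hij
      simp [hij]
    exact (PdLE.of_projective (A := MvPolynomial (V ⊕ V) K)).of_equiv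
      (Submodule.quotEquivOfEqBot _ h).symm
  | insert z Z hz ih =>
    have h : cliqueVarIdeal K c (insert z Z) = cliqueVarIdeal K c Z ⊔ Ideal.span {X z} := by
      rw [cliqueVarIdeal, Finset.coe_insert, Set.image_insert_eq, Set.insert_eq, Set.union_comm,
        Ideal.span_union, ← sup_assoc, cliqueVarIdeal]
    rw [h, Finset.card_insert_of_notMem hz]
    refine pdLE_quotient_sup_span_singleton (isPrime_cliqueVarIdeal fun z _ w hw => ?_) _ ih
    rwa [hc, hc] at hw

/-- The number of points moved by `c`, which for idempotent `c` is the number of points minus the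
number of nonempty fibres. -/
def movedCard (c : V → V) : ℕ := (Finset.univ.filter fun v => c v ≠ v).card

theorem pdLE_cliqueVarIdeal {c : V → V} (hc : ∀ v, c (c v) = c v) {Z : Finset (V ⊕ V)}
    (hZ : IsolatedIn c Z) :
    PdLE (MvPolynomial (V ⊕ V) K) (MvPolynomial (V ⊕ V) K ⧸ cliqueVarIdeal K c Z)
      (movedCard c + Z.card) := by
  obtain ⟨r, hr⟩ : ∃ r, movedCard c = r := ⟨_, rfl⟩
  induction r using Nat.strong_induction_on generalizing c Z with | _ r ih
  by_cases hid : ∀ v, c v = v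
  · exact (pdLE_cliqueVarIdeal_of_id hid Z).mono (Nat.le_add_left _ _)
  push Not at hid
  obtain ⟨m, hm⟩ := hid
  set ρ := c m with hρ
  have hcρ : c ρ = ρ := hc m
  have hne : ∀ v, c v ≠ m := by
    intro v hv
    have := hc v
    rw [hv] at this
    exact hm this
  set c₀ := Function.update c m m with hc₀
  have hc₀m : c₀ m = m := Function.update_self _ _ _
  have hc₀v : ∀ v, v ≠ m → c₀ v = c v := fun v hv => Function.update_of_ne hv _ _
  have hidem₀ : ∀ v, c₀ (c₀ v) = c₀ v := by
    intro v
    by_cases hv : v = m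
    · rw [hv, hc₀m, hc₀m]
    · rw [hc₀v v hv, hc₀v _ (hne v), hc]
  have hc₀ρ : c₀ ρ = ρ := by rw [hc₀v _ hm, hcρ]
  have hZm : ∀ z ∈ Z, Sum.elim id id z ≠ m := by
    rintro z hz h
    exact hm (by rw [← h]; exact hZ z hz ρ (by rw [h, hcρ]))
  have hZρ : ∀ z ∈ Z, Sum.elim id id z ≠ ρ := by
    rintro z hz h
    exact hm (by rw [← h]; exact (hZ z hz m (by rw [h, hcρ])).symm)
  have hZ₀ : IsolatedIn c₀ Z := by
    intro z hz w hw
    rw [hc₀v _ (hZm z hz)] at hw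
    by_cases h : w = m
    · rw [h, hc₀m] at hw
      exact absurd hw.symm (hne _)
    · rw [hc₀v _ h] at hw
      exact hZ z hz w hw
  have hmoved₀ : movedCard c₀ + 1 = movedCard c := by
    have : (Finset.univ.filter fun v => c₀ v ≠ v) =
        (Finset.univ.filter fun v => c v ≠ v).erase m := by
      ext v
      by_cases h : v = m
      · simp [h, hc₀m]
      · simp [h, hc₀v v h]
    rw [movedCard, movedCard, this, Finset.card_erase_add_one (by simpa using hm)]
  let C : Finset V := Finset.univ.filter fun v => c₀ v = ρ
  let c₁ : V → V := fun v => if c₀ v = ρ then v else c₀ v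
  let Z₁ : Finset (V ⊕ V) := Z ∪ C.image Sum.inl
  have hc₁C : ∀ v, c₀ v = ρ → c₁ v = v := fun v hv => if_pos hv
  have hc₁N : ∀ v, c₀ v ≠ ρ → c₁ v = c₀ v := fun v hv => if_neg hv
  have hidem₁ : ∀ v, c₁ (c₁ v) = c₁ v := by
    intro v
    by_cases h : c₀ v = ρ
    · rw [hc₁C v h, hc₁C v h]
    · rw [hc₁N v h, hc₁N _ (by rwa [hidem₀]), hidem₀]
  have hfib₁ : ∀ i j, c₁ i = c₁ j → i = j ∨ (c₀ i = c₀ j ∧ c₀ i ≠ ρ) := by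
    intro i j h
    by_cases hi : c₀ i = ρ <;> by_cases hj : c₀ j = ρ
    · rw [hc₁C i hi, hc₁C j hj] at h
      exact Or.inl h
    · rw [hc₁C i hi, hc₁N j hj] at h
      rw [h, hidem₀] at hi
      exact absurd hi hj
    · rw [hc₁N i hi, hc₁C j hj] at h
      rw [← h, hidem₀] at hj
      exact absurd hj hi
    · rw [hc₁N i hi, hc₁N j hj] at h
      exact Or.inr ⟨h, hi⟩
  have hZ₁ : IsolatedIn c₁ Z₁ := by
    intro z hz w hw
    rcases hfib₁ _ _ hw with h | ⟨h, h'⟩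
    · exact h
    · rcases Finset.mem_union.1 hz with hz | hz
      · exact hZ₀ z hz w h
      · obtain ⟨v, hv, rfl⟩ := Finset.mem_image.1 hz
        simp only [C, Finset.mem_filter, Finset.mem_univ, true_and] at hv
        exact absurd (h.trans hv) h'
  have hcard : movedCard c₁ + Z₁.card ≤ movedCard c₀ + Z.card + 1 := by
    have h₁ : Z₁.card ≤ Z.card + C.card :=
      (Finset.card_union_le _ _).trans (Nat.add_le_add_left Finset.card_image_le _)
    have hρC : ρ ∈ C := by simp [C, hc₀ρ]
    have h₂ := Finset.card_erase_add_one hρC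
    have h₃ : movedCard c₁ + (C.erase ρ).card ≤ movedCard c₀ := by
      rw [movedCard, movedCard, ← Finset.card_union_of_disjoint]
      · apply Finset.card_le_card
        intro v hv
        simp only [Finset.mem_union, Finset.mem_filter, Finset.mem_univ, true_and,
          Finset.mem_erase, C] at hv ⊢
        rcases hv with hv | ⟨hv, hv'⟩
        · by_cases h : c₀ v = ρ
          · exact absurd (hc₁C v h) hv
          · rwa [hc₁N v h] at hv
        · rw [hv']
          exact hv.symm
      · rw [Finset.disjoint_left]
        intro v hv hv'
        simp only [Finset.mem_filter, Finset.mem_univ, true_and, Finset.mem_erase, C] at hv hv'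
        exact hv (hc₁C v hv'.2)
    omega
  have hmoved₁ : movedCard c₁ ≤ movedCard c₀ := by
    refine Finset.card_le_card fun v hv => ?_
    simp only [Finset.mem_filter, Finset.mem_univ, true_and] at hv ⊢
    by_cases h : c₀ v = ρ
    · exact absurd (hc₁C v h) hv
    · rwa [hc₁N v h] at hv
  let p : {i // c₀ i = ρ} → MvPolynomial (V ⊕ V) K := fun i => X (Sum.inl i.1)
  let q : {i // c₀ i = ρ} → MvPolynomial (V ⊕ V) K := fun i => minor K i.1 m
  have hp : cliqueVarIdeal K c₀ Z ⊔ Ideal.span (Set.range p) = cliqueVarIdeal K c₁ Z₁ := by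
    have hX : ∀ v, c₀ v = ρ → X (Sum.inl v) ∈ cliqueVarIdeal K c₁ Z₁ := fun v hv =>
      X_mem_cliqueVarIdeal (Finset.mem_union_right _ (Finset.mem_image_of_mem _ (by simpa [C])))
    apply le_antisymm
    · refine sup_le (cliqueVarIdeal_le (fun i j hij => ?_) fun z hz =>
        X_mem_cliqueVarIdeal (Finset.mem_union_left _ hz)) (Ideal.span_le.2 ?_)
      · by_cases hi : c₀ i = ρ
        · exact sub_mem (Ideal.mul_mem_right _ _ (hX i hi))
            (Ideal.mul_mem_right _ _ (hX j (hij ▸ hi)))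
        · exact minor_mem_cliqueVarIdeal (by rw [hc₁N i hi, hc₁N j (hij ▸ hi), hij])
      · rintro _ ⟨i, rfl⟩
        exact hX _ i.2
    · refine cliqueVarIdeal_le (fun i j hij => ?_) fun z hz => ?_
      · rcases hfib₁ _ _ hij with rfl | h
        · simp
        · exact Ideal.mem_sup_left (minor_mem_cliqueVarIdeal h.1)
      · rcases Finset.mem_union.1 hz with hz | hz
        · exact Ideal.mem_sup_left (X_mem_cliqueVarIdeal hz)
        · obtain ⟨v, hv, rfl⟩ := Finset.mem_image.1 hz
          exact Ideal.mem_sup_right (Ideal.subset_span ⟨⟨v, by simpa [C] using hv⟩, rfl⟩)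
  have hq : cliqueVarIdeal K c₀ Z ⊔ Ideal.span (Set.range q) = cliqueVarIdeal K c Z := by
    apply le_antisymm
    · refine sup_le (cliqueVarIdeal_le (fun i j hij => ?_) fun z hz =>
        X_mem_cliqueVarIdeal hz) (Ideal.span_le.2 ?_)
      · by_cases hi : i = m <;> by_cases hj : j = m
        · simp [hi, hj]
        · rw [hi, hc₀m, hc₀v j hj] at hij
          exact absurd hij.symm (hne _)
        · rw [hj, hc₀m, hc₀v i hi] at hij
          exact absurd hij (hne _)
        · rw [hc₀v i hi, hc₀v j hj] at hij
          exact minor_mem_cliqueVarIdeal hij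
      · rintro _ ⟨⟨i, hi⟩, rfl⟩
        refine minor_mem_cliqueVarIdeal ?_
        have : i ≠ m := by
          rintro rfl
          exact hm (hi.symm.trans hc₀m)
        rw [← hc₀v i this, hi]
    · refine cliqueVarIdeal_le (fun i j hij => ?_) fun z hz =>
        Ideal.mem_sup_left (X_mem_cliqueVarIdeal hz)
      by_cases hi : i = m <;> by_cases hj : j = m
      · simp [hi, hj]
      · rw [minor_swap j i, hi]
        exact Ideal.mem_sup_right (neg_mem
          (Ideal.subset_span ⟨⟨j, by rw [hc₀v j hj, ← hij, hi]⟩, rfl⟩))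
      · rw [hj]
        exact Ideal.mem_sup_right
          (Ideal.subset_span ⟨⟨i, by rw [hc₀v i hi, hij, hj]⟩, rfl⟩)
      · exact Ideal.mem_sup_left
          (minor_mem_cliqueVarIdeal (by rw [hc₀v i hi, hc₀v j hj, hij]))
  have h₀ := ih (movedCard c₀) (by omega) hidem₀ hZ₀ rfl
  have h₁ := (ih (movedCard c₁) (by omega) hidem₁ hZ₁ rfl).mono hcard
  rw [← hp] at h₁
  have := pdLE_quotient_of_proportional (isPrime_cliqueVarIdeal hZ₀) p q ⟨ρ, hc₀ρ⟩
    (X_notMem_cliqueVarIdeal hZ₀ fun h => hZρ _ h rfl)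
    (minor_notMem_cliqueVarIdeal hZ₀ (by rw [hc₀ρ, hc₀m]; exact hm) hZρ hZm)
    (fun i => by
      have : X (Sum.inl m) * minor K i.1 ρ ∈ cliqueVarIdeal K c₀ Z :=
        Ideal.mul_mem_left _ _ (minor_mem_cliqueVarIdeal (by rw [i.2, hc₀ρ]))
      convert this using 1
      simp only [p, q, minor]
      ring) h₀ h₁
  rw [hq] at this
  exact this.mono (by omega)

end CliqueUnion

section GraphBound
open MvPolynomial

variable {V : Type}

/-- The graph obtained from `G` by making `A` a clique. -/
def addClique (G : SimpleGraph V) (A : Finset V) : SimpleGraph V where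
  Adj i j := G.Adj i j ∨ (i ≠ j ∧ i ∈ A ∧ j ∈ A)
  symm := ⟨fun _ _ h => h.imp (fun h => h.symm) fun ⟨h₁, h₂, h₃⟩ => ⟨h₁.symm, h₃, h₂⟩⟩
  loopless := ⟨fun i h => h.elim (G.loopless.irrefl i) fun h => h.1 rfl⟩

/-- The induced subgraph on `W` is the join of two isolated vertices with another graph. -/
def IsJoinOn (G : SimpleGraph V) (W : Finset V) : Prop :=
  ∃ a ∈ W, ∃ b ∈ W, a ≠ b ∧ ¬G.Adj a b ∧ ∀ v ∈ W, v ≠ a → v ≠ b → G.Adj v a ∧ G.Adj v b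

/-- The induced subgraph on `W` is complete. -/
def IsCompleteOn (G : SimpleGraph V) (W : Finset V) : Prop :=
  ∀ a ∈ W, ∀ b ∈ W, a ≠ b → G.Adj a b

variable (K : Type) [Field K]

/-- The binomial edge ideal of `G` plus all variables at vertices outside `W`. -/
noncomputable def inducedIdeal (W : Finset V) (G : SimpleGraph V) :
    Ideal (MvPolynomial (V ⊕ V) K) :=
  Ideal.span (X '' {z | Sum.elim id id z ∉ W}) ⊔ binomialEdgeIdeal K G

variable {K}

theorem X_mem_inducedIdeal {W : Finset V} {G : SimpleGraph V} {z : V ⊕ V}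
    (hz : Sum.elim id id z ∉ W) : X z ∈ inducedIdeal K W G :=
  Ideal.mem_sup_left (Ideal.subset_span ⟨z, hz, rfl⟩)

theorem minor_mem_binomialEdgeIdeal {G : SimpleGraph V} {i j : V} (h : G.Adj i j) :
    minor K i j ∈ binomialEdgeIdeal K G :=
  Ideal.subset_span ⟨i, j, h, rfl⟩

theorem binomialEdgeIdeal_le {G : SimpleGraph V} {I : Ideal (MvPolynomial (V ⊕ V) K)}
    (h : ∀ i j, G.Adj i j → minor K i j ∈ I) : binomialEdgeIdeal K G ≤ I := by
  refine Ideal.span_le.2 ?_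
  rintro _ ⟨i, j, hij, rfl⟩
  exact h i j hij

theorem minor_mem_inducedIdeal {W : Finset V} {G : SimpleGraph V} {i j : V} (h : G.Adj i j) :
    minor K i j ∈ inducedIdeal K W G :=
  Ideal.mem_sup_right (minor_mem_binomialEdgeIdeal h)

theorem inducedIdeal_le {W : Finset V} {G : SimpleGraph V}
    {I : Ideal (MvPolynomial (V ⊕ V) K)} (h₁ : ∀ z, Sum.elim id id z ∉ W → X z ∈ I)
    (h₂ : ∀ i j, G.Adj i j → minor K i j ∈ I) : inducedIdeal K W G ≤ I := by
  refine sup_le (Ideal.span_le.2 ?_) (binomialEdgeIdeal_le h₂)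
  rintro _ ⟨z, hz, rfl⟩
  exact h₁ z hz

theorem X_mul_minor_mem {I : Ideal (MvPolynomial (V ⊕ V) K)} {i j k : V}
    (hj : minor K i j ∈ I) (hk : minor K i k ∈ I) :
    ∀ z : V ⊕ V, Sum.elim id id z = i → X z * minor K j k ∈ I := by
  rintro (z | z) rfl
  · have := sub_mem (Ideal.mul_mem_left I (X (Sum.inl j)) hk)
      (Ideal.mul_mem_left I (X (Sum.inl k)) hj)
    convert this using 1
    simp only [minor, Sum.elim_inl, id]
    ring
  · have := sub_mem (Ideal.mul_mem_left I (X (Sum.inr j)) hk)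
      (Ideal.mul_mem_left I (X (Sum.inr k)) hj)
    convert this using 1
    simp only [minor, Sum.elim_inr, id]
    ring

theorem inducedIdeal_inf [DecidableEq V] {G : SimpleGraph V} {W T A : Finset V}
    (hTA : ∀ t ∈ T, ∀ a ∈ A, G.Adj t a) :
    inducedIdeal K W (addClique G A) ⊓ inducedIdeal K (W \ T) G = inducedIdeal K W G := by
  classical
  have hAT : ∀ a ∈ A, a ∉ T := fun a ha ht => G.loopless.irrefl _ (hTA a ht a ha)
  apply le_antisymm
  · rintro h ⟨h₁, h₂⟩
    let E : Ideal (MvPolynomial (V ⊕ V) K) :=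
      Ideal.span {f | ∃ i ∈ A, ∃ j ∈ A, f = minor K i j}
    have hle : inducedIdeal K W (addClique G A) ≤ inducedIdeal K W G ⊔ E := by
      refine inducedIdeal_le (fun z hz => Ideal.mem_sup_left (X_mem_inducedIdeal hz))
        fun i j hij => ?_
      rcases hij with hij | ⟨_, hi, hj⟩
      · exact Ideal.mem_sup_left (minor_mem_inducedIdeal hij)
      · exact Ideal.mem_sup_right (Ideal.subset_span ⟨i, hi, j, hj, rfl⟩)
    obtain ⟨g, hg, k, hk, rfl⟩ := Submodule.mem_sup.1 (hle h₁)
    refine add_mem hg ?_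
    have hmono : inducedIdeal K W G ≤ inducedIdeal K (W \ T) G :=
      inducedIdeal_le (fun z hz => X_mem_inducedIdeal fun hz' => hz (Finset.mem_sdiff.1 hz').1)
        fun i j hij => minor_mem_inducedIdeal hij
    have hk' : k ∈ inducedIdeal K (W \ T) G := by
      have := sub_mem h₂ (hmono hg)
      rwa [add_sub_cancel_left] at this
    let Z : Set (V ⊕ V) := {z | Sum.elim id id z ∈ T}
    have hκ : inducedIdeal K (W \ T) G ≤
        (inducedIdeal K W G).comap (killMap K Z).toRingHom := by
      refine inducedIdeal_le (fun z hz => ?_) fun i j hij => ?_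
      · change killMap K Z (X z) ∈ inducedIdeal K W G
        rw [killMap_X]
        split_ifs with h
        · exact zero_mem _
        · exact X_mem_inducedIdeal fun hW => hz (Finset.mem_sdiff.2 ⟨hW, h⟩)
      · change killMap K Z (minor K i j) ∈ inducedIdeal K W G
        by_cases hi : i ∈ T
        · simp [minor, killMap_X, Z, hi]
        · by_cases hj : j ∈ T
          · simp [minor, killMap_X, Z, hj]
          · rw [killMap_minor Z hi hi hj hj]
            exact minor_mem_inducedIdeal hij
    have hdiff : k - killMap K Z k ∈ inducedIdeal K W G := by
      refine Submodule.span_induction (p := fun k _ => k - killMap K Z k ∈ inducedIdeal K W G)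
        ?_ (by simp) (fun x y _ _ hx hy => ?_) (fun a x hx h => ?_) hk
      · rintro _ ⟨i, hi, j, hj, rfl⟩
        rw [killMap_minor Z (hAT i hi) (hAT i hi) (hAT j hj) (hAT j hj), sub_self]
        exact zero_mem _
      · rw [map_add, add_sub_add_comm]
        exact add_mem hx hy
      · have h₁ : (a - killMap K Z a) * x ∈ inducedIdeal K W G := by
          have hZE : Ideal.span (X '' Z) * E ≤ inducedIdeal K W G := by
            rw [Ideal.span_mul_span', Ideal.span_le]
            rintro _ ⟨_, ⟨z, hz, rfl⟩, _, ⟨i, hi, j, hj, rfl⟩, rfl⟩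
            exact X_mul_minor_mem (minor_mem_inducedIdeal (hTA _ hz i hi))
              (minor_mem_inducedIdeal (hTA _ hz j hj)) z rfl
          exact hZE (Ideal.mul_mem_mul (sub_killMap_mem Z a) hx)
        have h₂ := Ideal.mul_mem_left _ (killMap K Z a) h
        rw [smul_eq_mul, map_mul]
        convert add_mem h₁ h₂ using 1
        ring
    have := add_mem hdiff (hκ hk')
    simpa using this
  · refine le_inf ?_ ?_
    · exact inducedIdeal_le (fun z hz => X_mem_inducedIdeal hz)
        fun i j hij => minor_mem_inducedIdeal (Or.inl hij)
    · exact inducedIdeal_le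
        (fun z hz => X_mem_inducedIdeal fun hz' => hz (Finset.mem_sdiff.1 hz').1)
        fun i j hij => minor_mem_inducedIdeal hij

theorem inducedIdeal_sup [DecidableEq V] {G : SimpleGraph V} {W T A : Finset V} :
    inducedIdeal K W (addClique G A) ⊔ inducedIdeal K (W \ T) G =
      inducedIdeal K (W \ T) (addClique G A) := by
  apply le_antisymm
  · refine sup_le ?_ ?_
    · exact inducedIdeal_le
        (fun z hz => X_mem_inducedIdeal fun hz' => hz (Finset.mem_sdiff.1 hz').1)
        fun i j hij => minor_mem_inducedIdeal hij
    · exact inducedIdeal_le (fun z hz => X_mem_inducedIdeal hz)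
        fun i j hij => minor_mem_inducedIdeal (Or.inl hij)
  · exact inducedIdeal_le (fun z hz => Ideal.mem_sup_right (X_mem_inducedIdeal hz))
      fun i j hij => Ideal.mem_sup_left (minor_mem_inducedIdeal hij)

variable [Fintype V] [DecidableEq V]

theorem exists_pdLE_of_transitive {G : SimpleGraph V} {W : Finset V} (hW : W.Nonempty)
    (htrans : ∀ a ∈ W, ∀ b ∈ W, ∀ t ∈ W, a ≠ b → G.Adj t a → G.Adj t b → G.Adj a b) :
    ∃ d, PdLE (MvPolynomial (V ⊕ V) K) (MvPolynomial (V ⊕ V) K ⧸ inducedIdeal K W G) d ∧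
      d + W.card + 1 ≤ 2 * Fintype.card V ∧
      (¬IsCompleteOn G W → d + W.card + 2 ≤ 2 * Fintype.card V) := by
  classical
  let s : Setoid V :=
    { r := fun i j => i = j ∨ (i ∈ W ∧ j ∈ W ∧ G.Adj i j)
      iseqv :=
        { refl := fun _ => Or.inl rfl
          symm := by
            rintro i j (rfl | ⟨h₁, h₂, h₃⟩)
            · exact Or.inl rfl
            · exact Or.inr ⟨h₂, h₁, h₃.symm⟩
          trans := by
            rintro i j k (rfl | ⟨h₁, h₂, h₃⟩) (rfl | ⟨h₄, h₅, h₆⟩)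
            · exact Or.inl rfl
            · exact Or.inr ⟨h₄, h₅, h₆⟩
            · exact Or.inr ⟨h₁, h₂, h₃⟩
            · by_cases h : i = k
              · exact Or.inl h
              · exact Or.inr ⟨h₁, h₅, htrans i h₁ k h₅ j h₂ h h₃.symm h₆⟩ } }
  let c : V → V := fun v => (Quotient.mk s v).out
  have hcv : ∀ v, s (c v) v := fun v => Quotient.exact (Quotient.out_eq _)
  have hc : ∀ i j, c i = c j ↔ s i j := by
    intro i j
    constructor
    · intro h
      exact s.trans (s.symm (hcv i)) (h ▸ hcv j)
    · intro h
      exact congrArg Quotient.out (Quotient.sound h)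
  have hidem : ∀ v, c (c v) = c v := fun v => (hc _ _).2 (hcv v)
  have hmem : ∀ v ∈ W, c v ∈ W := by
    intro v hv
    rcases hcv v with h | h
    · exact h.symm ▸ hv
    · exact h.1
  have hoff : ∀ v, c v ≠ v → v ∈ W := by
    intro v hv
    rcases hcv v with h | h
    · exact absurd h hv
    · exact h.2.1
  let Z : Finset (V ⊕ V) := Finset.univ.filter fun z => Sum.elim id id z ∉ W
  have hZ : IsolatedIn c Z := by
    intro z hz w hw
    rcases (hc _ _).1 hw with h | h
    · exact h
    · exact absurd h.2.1 (by simpa [Z] using hz)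
  have hZcard : Z.card + 2 * W.card = 2 * Fintype.card V := by
    have : Z = (Finset.univ \ W).disjSum (Finset.univ \ W) := by
      ext (z | z) <;> simp [Z]
    have h := Finset.card_sdiff_add_card_eq_card (Finset.subset_univ W)
    rw [Finset.card_univ] at h
    rw [this, Finset.card_disjSum]
    omega
  have hideal : inducedIdeal K W G = cliqueVarIdeal K c Z := by
    apply le_antisymm
    · have hX : ∀ z : V ⊕ V, Sum.elim id id z ∉ W → X z ∈ cliqueVarIdeal K c Z := fun z hz =>
        X_mem_cliqueVarIdeal (by simpa [Z] using hz)
      refine inducedIdeal_le hX fun i j hij => ?_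
      by_cases hi : i ∈ W
      · by_cases hj : j ∈ W
        · exact minor_mem_cliqueVarIdeal ((hc _ _).2 (Or.inr ⟨hi, hj, hij⟩))
        · exact sub_mem (Ideal.mul_mem_left _ _ (hX (Sum.inr j) hj))
            (Ideal.mul_mem_right _ _ (hX (Sum.inl j) hj))
      · exact sub_mem (Ideal.mul_mem_right _ _ (hX (Sum.inl i) hi))
          (Ideal.mul_mem_left _ _ (hX (Sum.inr i) hi))
    · refine cliqueVarIdeal_le (fun i j hij => ?_)
        fun z hz => X_mem_inducedIdeal (by simpa [Z] using hz)
      rcases (hc _ _).1 hij with rfl | h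
      · simp
      · exact minor_mem_inducedIdeal h.2.2
  refine ⟨_, hideal ▸ pdLE_cliqueVarIdeal hidem hZ, ?_, fun hcomp => ?_⟩
  · obtain ⟨w, hw⟩ := hW
    have h : movedCard c ≤ (W.erase (c w)).card := Finset.card_le_card fun v hv => by
      simp only [Finset.mem_filter, Finset.mem_univ, true_and] at hv
      refine Finset.mem_erase.2 ⟨?_, hoff v hv⟩
      rintro rfl
      exact hv (hidem w)
    have := Finset.card_erase_add_one (hmem w hw)
    omega
  · simp only [IsCompleteOn, not_forall] at hcomp
    obtain ⟨a, ha, b, hb, hab, hadj⟩ := hcomp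
    have hne : c b ≠ c a := fun h => by
      rcases (hc _ _).1 h with h | h
      · exact hab h.symm
      · exact hadj h.2.2.symm
    have h : movedCard c ≤ ((W.erase (c a)).erase (c b)).card :=
      Finset.card_le_card fun v hv => by
        simp only [Finset.mem_filter, Finset.mem_univ, true_and] at hv
        refine Finset.mem_erase.2 ⟨?_, Finset.mem_erase.2 ⟨?_, hoff v hv⟩⟩
        · rintro rfl
          exact hv (hidem b)
        · rintro rfl
          exact hv (hidem a)
    have h₁ := Finset.card_erase_add_one (hmem a ha)
    have h₂ := Finset.card_erase_add_one (Finset.mem_erase.2 ⟨hne, hmem b hb⟩)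
    omega

end GraphBound

section GraphInduction
open MvPolynomial

variable {V : Type} {G : SimpleGraph V} {W : Finset V} [DecidableEq V]

theorem not_isJoinOn_addClique {T A : Finset V} (hTW : T ⊆ W)
    (hTA : ∀ t ∈ T, ∀ a ∈ A, G.Adj t a) (hA : ∀ v ∈ W, (∀ t ∈ T, G.Adj t v) → v ∈ A)
    (hG : ¬IsJoinOn G W) : ¬IsJoinOn (addClique G A) W := by
  have key : ∀ c ∈ W, ∀ d ∈ W, c ≠ d → ¬(addClique G A).Adj c d →
      (∀ v ∈ W, v ≠ c → v ≠ d → (addClique G A).Adj v c ∧ (addClique G A).Adj v d) →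
      c ∈ A := by
    intro c hc d hd hcd hadj hall
    by_contra hcA
    have hold : ∀ v ∈ W, v ≠ c → v ≠ d → G.Adj v c := fun v hv h₁ h₂ =>
      (hall v hv h₁ h₂).1.resolve_right fun h => hcA h.2.2
    by_cases hdA : d ∈ A
    · refine hcA (hA c hc fun t ht => hold t (hTW ht) ?_ ?_)
      · rintro rfl
        exact hadj (Or.inl (hTA t ht d hdA))
      · rintro rfl
        exact G.loopless.irrefl _ (hTA t ht t hdA)
    · exact hG ⟨c, hc, d, hd, hcd, fun h => hadj (Or.inl h), fun v hv h₁ h₂ =>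
        ⟨hold v hv h₁ h₂, (hall v hv h₁ h₂).2.resolve_right fun h => hdA h.2.2⟩⟩
  rintro ⟨c, hc, d, hd, hcd, hadj, hall⟩
  have h₁ := key c hc d hd hcd hadj hall
  have h₂ := key d hd c hc hcd.symm (fun h => hadj h.symm)
    fun v hv h h' => (hall v hv h' h).symm
  exact hadj (Or.inr ⟨hcd, h₁, h₂⟩)

theorem not_isJoinOn_of_no_common {a b : V} (ha : a ∈ W) (hb : b ∈ W) (hab : a ≠ b)
    (hadj : ¬G.Adj a b) (hcomm : ∀ t ∈ W, ¬(G.Adj t a ∧ G.Adj t b)) (hW : 3 ≤ W.card) :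
    ¬IsJoinOn G W := by
  rintro ⟨c, hc, d, hd, hcd, -, hall⟩
  have key : ∀ c d, c ∈ W → c ≠ d →
      (∀ v ∈ W, v ≠ c → v ≠ d → G.Adj v c ∧ G.Adj v d) → a = c ∨ b = c := by
    intro c d hc hcd hall
    by_contra! h
    by_cases had : a = d
    · subst had
      exact hadj (hall b hb h.2 hab.symm).2.symm
    · by_cases hbd : b = d
      · subst hbd
        exact hadj (hall a ha h.1 hab).2
      · exact hcomm c hc ⟨(hall a ha h.1 had).1.symm, (hall b hb h.2 hbd).1.symm⟩
  obtain ⟨e, he, hec, hed⟩ : ∃ e ∈ W, e ≠ c ∧ e ≠ d := by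
    obtain ⟨e, he, h⟩ := Finset.exists_mem_notMem_of_card_lt_card
      ((Finset.card_le_two (a := c) (b := d)).trans_lt hW)
    simp only [Finset.mem_insert, Finset.mem_singleton, not_or] at h
    exact ⟨e, he, h⟩
  have hE := hall e he hec hed
  rcases key c d hc hcd hall with rfl | rfl <;>
    rcases key d _ hd hcd.symm (fun v hv h h' => (hall v hv h' h).symm) with rfl | rfl
  · exact hcd rfl
  · exact hcomm e he hE
  · exact hcomm e he hE.symm
  · exact hcd rfl

variable {K : Type} [Field K] [Fintype V]

theorem pdLE_inducedIdeal (G : SimpleGraph V) (W : Finset V) :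
    (2 ≤ W.card → ∀ d, 2 * Fintype.card V ≤ d + 3 →
      PdLE (MvPolynomial (V ⊕ V) K) (MvPolynomial (V ⊕ V) K ⧸ inducedIdeal K W G) d) ∧
    (2 ≤ W.card → (W.card = 2 → ¬IsCompleteOn G W) → ∀ d, 2 * Fintype.card V ≤ d + 4 →
      PdLE (MvPolynomial (V ⊕ V) K) (MvPolynomial (V ⊕ V) K ⧸ inducedIdeal K W G) d) ∧
    (3 ≤ W.card → ¬IsJoinOn G W → (W.card = 3 → ¬IsCompleteOn G W) →
      ∀ d, 2 * Fintype.card V ≤ d + 5 →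
      PdLE (MvPolynomial (V ⊕ V) K) (MvPolynomial (V ⊕ V) K ⧸ inducedIdeal K W G) d) := by
  classical
  let missing : SimpleGraph V → Finset V → Finset (V × V) := fun G W =>
    (W ×ˢ W).filter fun p => p.1 ≠ p.2 ∧ ¬G.Adj p.1 p.2
  obtain ⟨N, hN⟩ : ∃ N, W.card + (missing G W).card = N := ⟨_, rfl⟩
  induction N using Nat.strong_induction_on generalizing G W with | _ N ih
  by_cases htrans : ∀ a ∈ W, ∀ b ∈ W, ∀ t ∈ W, a ≠ b → G.Adj t a → G.Adj t b → G.Adj a b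
  · by_cases hne : W.Nonempty
    · obtain ⟨e, he, h₁, h₂⟩ := exists_pdLE_of_transitive (K := K) hne htrans
      refine ⟨fun hW d hd => he.mono (by omega), fun hW hc d hd => ?_,
        fun hW _ hc d hd => ?_⟩
      · by_cases h : W.card = 2
        · have := h₂ (hc h)
          exact he.mono (by omega)
        · exact he.mono (by omega)
      · by_cases h : W.card = 3
        · have := h₂ (hc h)
          exact he.mono (by omega)
        · exact he.mono (by omega)
    · rw [Finset.not_nonempty_iff_eq_empty] at hne
      subst hne
      simp
  push Not at htrans
  obtain ⟨a, ha, b, hb, t, ht, hab, hta, htb, hadj⟩ := htrans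
  set T := W.filter fun v => G.Adj v a ∧ G.Adj v b with hT
  set A := W.filter fun v => ∀ s ∈ T, G.Adj s v with hA
  have htT : t ∈ T := Finset.mem_filter.2 ⟨ht, hta, htb⟩
  have hTW : T ⊆ W := Finset.filter_subset _ _
  have hTA : ∀ s ∈ T, ∀ v ∈ A, G.Adj s v := fun s hs v hv => (Finset.mem_filter.1 hv).2 s hs
  have haA : a ∈ A := Finset.mem_filter.2 ⟨ha, fun s hs => (Finset.mem_filter.1 hs).2.1⟩
  have hbA : b ∈ A := Finset.mem_filter.2 ⟨hb, fun s hs => (Finset.mem_filter.1 hs).2.2⟩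
  have haW : a ∈ W \ T := Finset.mem_sdiff.2
    ⟨ha, fun h => G.loopless.irrefl _ (Finset.mem_filter.1 h).2.1⟩
  have hbW : b ∈ W \ T := Finset.mem_sdiff.2
    ⟨hb, fun h => G.loopless.irrefl _ (Finset.mem_filter.1 h).2.2⟩
  have hncomp : ¬IsCompleteOn G (W \ T) := fun h => hadj (h a haW b hbW hab)
  have hcardT : (W \ T).card < W.card := by
    refine Finset.card_lt_card ⟨Finset.sdiff_subset, fun h => ?_⟩
    exact (Finset.mem_sdiff.1 (h ht)).2 htT
  have htwo : 2 ≤ (W \ T).card := by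
    have : ({a, b} : Finset V) ⊆ W \ T := by
      intro x hx
      simp only [Finset.mem_insert, Finset.mem_singleton] at hx
      rcases hx with rfl | rfl <;> assumption
    simpa [Finset.card_pair hab] using Finset.card_le_card this
  have hmissT : (missing G (W \ T)).card ≤ (missing G W).card :=
    Finset.card_le_card (Finset.filter_subset_filter _
      (Finset.product_subset_product Finset.sdiff_subset Finset.sdiff_subset))
  have hmissA : (missing (addClique G A) W).card < (missing G W).card := by
    refine Finset.card_lt_card ⟨fun p hp => ?_, fun h => ?_⟩
    · simp only [missing, Finset.mem_filter] at hp ⊢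
      exact ⟨hp.1, hp.2.1, fun h => hp.2.2 (Or.inl h)⟩
    · have : (a, b) ∈ missing G W := by simp [missing, ha, hb, hab, hadj]
      have := h this
      simp only [missing, Finset.mem_filter] at this
      exact this.2.2 (Or.inr ⟨hab, haA, hbA⟩)
  have hmissAT : (missing (addClique G A) (W \ T)).card ≤ (missing (addClique G A) W).card :=
    Finset.card_le_card (Finset.filter_subset_filter _
      (Finset.product_subset_product Finset.sdiff_subset Finset.sdiff_subset))
  have hinf := inducedIdeal_inf (K := K) (W := W) hTA
  have hsup := inducedIdeal_sup (K := K) (G := G) (W := W) (T := T) (A := A)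
  have combine : ∀ d,
      PdLE (MvPolynomial (V ⊕ V) K) (MvPolynomial (V ⊕ V) K ⧸
        inducedIdeal K W (addClique G A)) d →
      PdLE (MvPolynomial (V ⊕ V) K) (MvPolynomial (V ⊕ V) K ⧸ inducedIdeal K (W \ T) G) d →
      PdLE (MvPolynomial (V ⊕ V) K) (MvPolynomial (V ⊕ V) K ⧸
        inducedIdeal K (W \ T) (addClique G A)) (d + 1) →
      PdLE (MvPolynomial (V ⊕ V) K) (MvPolynomial (V ⊕ V) K ⧸ inducedIdeal K W G) d := by
    intro d h₁ h₂ h₃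
    rw [← hinf]
    rw [← hsup] at h₃
    exact pdLE_quotient_inf _ _ h₁ h₂ h₃
  obtain ⟨hA3, hA4, hA5⟩ := ih _ (by omega) (addClique G A) W rfl
  obtain ⟨hT3, hT4, hT5⟩ := ih _ (by omega) G (W \ T) rfl
  obtain ⟨hAT3, hAT4, -⟩ := ih _ (by omega) (addClique G A) (W \ T) rfl
  refine ⟨fun hW d hd => combine d (hA3 hW d hd) (hT3 htwo d hd) (hAT3 htwo _ (by omega)),
    fun hW hc d hd => combine d (hA4 hW (by omega) d hd) (hT4 htwo (fun _ => hncomp) d hd)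
      (hAT3 htwo _ (by omega)), fun hW hJ hc d hd => ?_⟩
  have hthree : 3 ≤ (W \ T).card := by
    by_contra hlt
    have hset : ({a, b} : Finset V) = W \ T := by
      refine Finset.eq_of_subset_of_card_le ?_ (by rw [Finset.card_pair hab]; omega)
      intro x hx
      simp only [Finset.mem_insert, Finset.mem_singleton] at hx
      rcases hx with rfl | rfl <;> assumption
    refine hJ ⟨a, ha, b, hb, hab, hadj, fun v hv h₁ h₂ => ?_⟩
    have hvT : v ∈ T := by
      by_contra h
      have := Finset.mem_sdiff.2 ⟨hv, h⟩
      rw [← hset] at this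
      simp [h₁, h₂] at this
    exact (Finset.mem_filter.1 hvT).2
  refine combine d (hA5 hW ?_ (by omega) d hd) (hT5 hthree ?_ (fun _ => hncomp) d hd)
    (hAT4 htwo (by omega) _ (by omega))
  · exact not_isJoinOn_addClique hTW hTA (fun v hv h => Finset.mem_filter.2 ⟨hv, h⟩) hJ
  · exact not_isJoinOn_of_no_common haW hbW hab hadj
      (fun s hs h => (Finset.mem_sdiff.1 hs).2 (Finset.mem_filter.2 ⟨(Finset.mem_sdiff.1 hs).1, h⟩))
      hthree

theorem pdLE_binomialEdgeIdeal (G : SimpleGraph V) (hcard : 3 ≤ Fintype.card V)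
    (hJ : ¬IsJoinOn G Finset.univ) (hc : Fintype.card V = 3 → G ≠ ⊤) :
    PdLE (MvPolynomial (V ⊕ V) K) (MvPolynomial (V ⊕ V) K ⧸ binomialEdgeIdeal K G)
      (2 * Fintype.card V - 5) := by
  have h := (pdLE_inducedIdeal (K := K) G Finset.univ).2.2 hcard hJ
    (fun h₃ hcomp => hc h₃ (by
      ext a b
      exact ⟨fun h => h.ne, fun h => hcomp a (Finset.mem_univ _) b (Finset.mem_univ _) h⟩))
    (2 * Fintype.card V - 5) (by omega)
  have hI : inducedIdeal K Finset.univ G = binomialEdgeIdeal K G := by simp [inducedIdeal]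
  rwa [hI] at h

end GraphInduction

section Height
open MvPolynomial

theorem height_le_card_of_mem_minimalPrimes {R ι : Type} [CommRing R] [IsNoetherianRing R]
    [Fintype ι] (g : ι → R) {P : Ideal R} (hP : P ∈ (Ideal.span (Set.range g)).minimalPrimes) :
    P.height ≤ Fintype.card ι := by
  classical
  refine (Ideal.height_le_spanRank_toENat_of_mem_minimalPrimes _ P hP).trans ?_
  rw [Submodule.spanRank_toENat_eq_iInf_finset_card]
  refine (iInf_le _ ⟨Finset.univ.image g, by simp [Ideal.submodule_span_eq]⟩).trans ?_
  exact_mod_cast Finset.card_image_le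

theorem height_le_card_of_mem_minimalPrimes_of_le {R ι : Type} [CommRing R] [IsNoetherianRing R]
    [Fintype ι] (g : ι → R) {I P : Ideal R} (hP : P ∈ I.minimalPrimes) (hg : ∀ i, g i ∈ P)
    (h : ∀ Q : Ideal R, Q.IsPrime → Q ≤ P → (∀ i, g i ∈ Q) → I ≤ Q) :
    P.height ≤ Fintype.card ι := by
  refine height_le_card_of_mem_minimalPrimes g ⟨⟨hP.1.1, ?_⟩, fun Q hQ hQP => ?_⟩
  · rw [Ideal.span_le]
    rintro _ ⟨i, rfl⟩
    exact hg i
  · exact hP.2 ⟨hQ.1, h Q hQ.1 hQP fun i => hQ.2 (Ideal.subset_span ⟨i, rfl⟩)⟩ hQP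

variable {V : Type} {K : Type} [Field K]

theorem minor_mem_of_minor_mem {P Q : Ideal (MvPolynomial (V ⊕ V) K)} (hQ : Q.IsPrime)
    (hQP : Q ≤ P) {i j k : V} (hi : ¬(X (Sum.inl i) ∈ P ∧ X (Sum.inr i) ∈ P))
    (hj : minor K i j ∈ Q) (hk : minor K i k ∈ Q) : minor K j k ∈ Q := by
  by_contra h
  exact hi ⟨hQP ((hQ.mem_or_mem (X_mul_minor_mem hj hk (Sum.inl i) rfl)).resolve_right h),
    hQP ((hQ.mem_or_mem (X_mul_minor_mem hj hk (Sum.inr i) rfl)).resolve_right h)⟩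

theorem minor_mem_of_mem_left {I : Ideal (MvPolynomial (V ⊕ V) K)} {i j : V}
    (h : X (Sum.inl i) ∈ I ∧ X (Sum.inr i) ∈ I) : minor K i j ∈ I :=
  sub_mem (Ideal.mul_mem_right _ _ h.1) (Ideal.mul_mem_left _ _ h.2)

theorem minor_mem_of_mem_right {I : Ideal (MvPolynomial (V ⊕ V) K)} {i j : V}
    (h : X (Sum.inl j) ∈ I ∧ X (Sum.inr j) ∈ I) : minor K i j ∈ I := by
  rw [minor_swap]
  exact neg_mem (minor_mem_of_mem_left h)

theorem isolatedIn_id (Z : Finset (V ⊕ V)) : IsolatedIn id Z := fun _ _ _ hw => hw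

variable [Fintype V] [DecidableEq V]

theorem exists_not_mem_of_mem_minimalPrimes [Nonempty V] {G : SimpleGraph V}
    {P : Ideal (MvPolynomial (V ⊕ V) K)} (hP : P ∈ (binomialEdgeIdeal K G).minimalPrimes) :
    ∃ i, ¬(X (Sum.inl i) ∈ P ∧ X (Sum.inr i) ∈ P) := by
  by_contra! hall
  let Z : Finset (V ⊕ V) := Finset.univ.image Sum.inl
  have hZ : ∀ i : V, X (Sum.inl i) ∈ cliqueVarIdeal K id Z := fun i =>
    X_mem_cliqueVarIdeal (Finset.mem_image_of_mem _ (Finset.mem_univ i))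
  have hle : P ≤ cliqueVarIdeal K id Z := by
    refine hP.2 ⟨isPrime_cliqueVarIdeal (isolatedIn_id Z), binomialEdgeIdeal_le fun i j _ =>
      sub_mem (Ideal.mul_mem_right _ _ (hZ i)) (Ideal.mul_mem_right _ _ (hZ j))⟩
      (cliqueVarIdeal_le ?_ ?_)
    · rintro i _ rfl
      simp
    · intro z hz
      obtain ⟨i, -, rfl⟩ := Finset.mem_image.1 hz
      exact (hall i).1
  obtain ⟨i⟩ := ‹Nonempty V›
  exact X_notMem_cliqueVarIdeal (isolatedIn_id Z) (z := Sum.inr i) (by simp [Z])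
    (hle (hall i).2)

theorem height_le_of_mem_minimalPrimes {G : SimpleGraph V} (hcard : 3 ≤ Fintype.card V)
    {P : Ideal (MvPolynomial (V ⊕ V) K)} (hP : P ∈ (binomialEdgeIdeal K G).minimalPrimes) :
    P.height ≤ (2 * Fintype.card V - 4 : ℕ) := by
  classical
  have hprime : P.IsPrime := hP.1.1
  have : Nonempty V := Fintype.card_pos_iff.1 (by omega)
  by_cases hall : ∀ j k, minor K j k ∈ P
  · obtain ⟨i, hi⟩ := exists_not_mem_of_mem_minimalPrimes hP
    have h := height_le_card_of_mem_minimalPrimes_of_le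
      (fun j : {j // j ≠ i} => minor K i j.1) hP (fun j => hall _ _) fun Q hQ hQP hQg => by
        have hQi : ∀ j, minor K i j ∈ Q := fun j => by
          by_cases hj : j = i
          · simp [hj]
          · exact hQg ⟨j, hj⟩
        exact binomialEdgeIdeal_le fun a b _ =>
          minor_mem_of_minor_mem hQ hQP hi (hQi a) (hQi b)
    refine h.trans ?_
    rw [Fintype.card_subtype_compl, Fintype.card_subtype_eq]
    exact_mod_cast (by omega)
  push Not at hall
  obtain ⟨j, k, hjk⟩ := hall
  let T : Set V := {i | X (Sum.inl i) ∈ P ∧ X (Sum.inr i) ∈ P}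
  let s : Setoid V :=
    { r := fun a b => a = b ∨ (a ∉ T ∧ b ∉ T ∧ minor K a b ∈ P)
      iseqv :=
        { refl := fun _ => Or.inl rfl
          symm := by
            rintro a b (rfl | ⟨h₁, h₂, h₃⟩)
            · exact Or.inl rfl
            · exact Or.inr ⟨h₂, h₁, by rw [minor_swap]; exact neg_mem h₃⟩
          trans := by
            rintro a b c (rfl | ⟨h₁, h₂, h₃⟩) (rfl | ⟨h₄, h₅, h₆⟩)
            · exact Or.inl rfl
            · exact Or.inr ⟨h₄, h₅, h₆⟩
            · exact Or.inr ⟨h₁, h₂, h₃⟩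
            · refine Or.inr ⟨h₁, h₅, minor_mem_of_minor_mem hprime le_rfl h₂ ?_ h₆⟩
              rw [minor_swap]
              exact neg_mem h₃ } }
  have hjT : j ∉ T := fun h => hjk (minor_mem_of_mem_left h)
  have hkT : k ∉ T := fun h => hjk (minor_mem_of_mem_right h)
  have hnjk : ¬s k j := by
    rintro (rfl | h)
    · simp at hjk
    · exact hjk (by rw [minor_swap]; exact neg_mem h.2.2)
  let r : V → V := fun v => if s v j then j else if s v k then k else (Quotient.mk s v).out
  have hrs : ∀ v, s (r v) v := by
    intro v
    simp only [r]
    split_ifs with h₁ h₂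
    · exact s.symm h₁
    · exact s.symm h₂
    · exact Quotient.exact (Quotient.out_eq _)
  have hreq : ∀ v w, s v w → r v = r w := by
    intro v w h
    have h₁ : ∀ x, s v x ↔ s w x := fun x => ⟨s.trans (s.symm h), s.trans h⟩
    simp only [r, h₁, Quotient.sound h]
  have hrj : r j = j := if_pos (s.refl j)
  have hrk : r k = k := (if_neg hnjk).trans (if_pos (s.refl k))
  let g : {v // v ∉ ({j, k} : Finset V)} × Bool → MvPolynomial (V ⊕ V) K := fun p =>
    if p.1.1 ∈ T then X (if p.2 then Sum.inr p.1.1 else Sum.inl p.1.1)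
    else minor K (r p.1.1) p.1.1
  have h := height_le_card_of_mem_minimalPrimes_of_le g hP (fun p => ?_)
    fun Q hQ hQP hQg => binomialEdgeIdeal_le fun a b hab => ?_
  · refine h.trans ?_
    have hne : j ≠ k := by
      rintro rfl
      simp at hjk
    rw [Fintype.card_prod, Fintype.card_bool, Fintype.card_subtype_compl, Fintype.card_coe,
      Finset.card_pair hne]
    exact_mod_cast (by omega)
  · obtain ⟨⟨v, hv⟩, e⟩ := p
    simp only [g]
    split_ifs with h₁ h₂
    · exact h₁.2
    · exact h₁.1
    · rcases hrs v with h | h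
      · simp [h]
      · exact h.2.2
  · have hQT : ∀ v ∈ T, X (Sum.inl v) ∈ Q ∧ X (Sum.inr v) ∈ Q := by
      intro v hv
      have hv' : v ∉ ({j, k} : Finset V) := by
        simp only [Finset.mem_insert, Finset.mem_singleton, not_or]
        exact ⟨fun h => hjT (h ▸ hv), fun h => hkT (h ▸ hv)⟩
      have h₁ := hQg (⟨v, hv'⟩, false)
      have h₂ := hQg (⟨v, hv'⟩, true)
      simp only [g, if_pos hv] at h₁ h₂
      exact ⟨h₁, h₂⟩
    have hQr : ∀ v ∉ T, minor K (r v) v ∈ Q := by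
      intro v hv
      by_cases hv' : v ∈ ({j, k} : Finset V)
      · simp only [Finset.mem_insert, Finset.mem_singleton] at hv'
        rcases hv' with rfl | rfl
        · simp [hrj]
        · simp [hrk]
      · have h₁ := hQg (⟨v, hv'⟩, false)
        simpa only [g, if_neg hv] using h₁
    by_cases ha : a ∈ T
    · exact minor_mem_of_mem_left (hQT a ha)
    by_cases hb : b ∈ T
    · exact minor_mem_of_mem_right (hQT b hb)
    have hr := hreq a b (Or.inr ⟨ha, hb, hP.1.2 (minor_mem_binomialEdgeIdeal hab)⟩)
    have hra : r a ∉ T := by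
      rcases hrs a with h | h
      · rwa [h]
      · exact h.1
    exact minor_mem_of_minor_mem hQ hQP hra (hQr a ha) (hr ▸ hQr b hb)

theorem card_le_height_cliqueVarIdeal (Z : Finset (V ⊕ V)) :
    (Z.card : ℕ∞) ≤ (cliqueVarIdeal K id Z).height := by
  induction Z using Finset.induction_on with
  | empty => simp
  | insert z Z hz ih =>
    have := isPrime_cliqueVarIdeal (K := K) (isolatedIn_id Z)
    have := isPrime_cliqueVarIdeal (K := K) (isolatedIn_id (insert z Z))
    have hlt : cliqueVarIdeal K id Z < cliqueVarIdeal K id (insert z Z) := by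
      refine ⟨cliqueVarIdeal_le (fun i j h => minor_mem_cliqueVarIdeal h)
        fun w hw => X_mem_cliqueVarIdeal (Finset.mem_insert_of_mem hw), fun h => ?_⟩
      exact X_notMem_cliqueVarIdeal (isolatedIn_id Z) hz
        (h (X_mem_cliqueVarIdeal (Finset.mem_insert_self z Z)))
    rw [Finset.card_insert_of_notMem hz, Nat.cast_add, Nat.cast_one]
    exact (add_le_add_left ih 1).trans (Ideal.height_add_one_le_of_lt_of_isPrime hlt)

theorem exists_minimalPrime_of_isJoinOn {G : SimpleGraph V} (hG : IsJoinOn G Finset.univ) :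
    ∃ P ∈ (binomialEdgeIdeal K G).minimalPrimes,
      ((2 * Fintype.card V - 4 : ℕ) : ℕ∞) ≤ P.height := by
  obtain ⟨a, -, b, -, hab, hadj, hall⟩ := hG
  let Z : Finset (V ⊕ V) := Finset.univ.filter fun z => Sum.elim id id z ∉ ({a, b} : Finset V)
  have hX : ∀ v, v ≠ a → v ≠ b → X (Sum.inl v) ∈ cliqueVarIdeal K id Z ∧
      X (Sum.inr v) ∈ cliqueVarIdeal K id Z := fun v h₁ h₂ =>
    ⟨X_mem_cliqueVarIdeal (by simp [Z, h₁, h₂]), X_mem_cliqueVarIdeal (by simp [Z, h₁, h₂])⟩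
  have hprime := isPrime_cliqueVarIdeal (K := K) (isolatedIn_id Z)
  have hab' : minor K a b ∉ cliqueVarIdeal K id Z :=
    minor_notMem_cliqueVarIdeal (isolatedIn_id Z) hab
      (by rintro z hz rfl; simp [Z] at hz) (by rintro z hz rfl; simp [Z] at hz)
  refine ⟨cliqueVarIdeal K id Z, ⟨⟨hprime, binomialEdgeIdeal_le fun i j hij => ?_⟩,
    fun Q hQ hQle => cliqueVarIdeal_le ?_ fun z hz => ?_⟩, ?_⟩
  · by_cases hi : i = a ∨ i = b
    · by_cases hj : j = a ∨ j = b
      · rcases hi with rfl | rfl <;> rcases hj with rfl | rfl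
        · simp
        · exact absurd hij hadj
        · exact absurd hij.symm hadj
        · simp
      · push Not at hj
        exact minor_mem_of_mem_right (hX j hj.1 hj.2)
    · push Not at hi
      exact minor_mem_of_mem_left (hX i hi.1 hi.2)
  · rintro i _ rfl
    simp
  · simp only [Z, Finset.mem_filter, Finset.mem_univ, true_and, Finset.mem_insert,
      Finset.mem_singleton, not_or] at hz
    have h := hall _ (Finset.mem_univ _) hz.1 hz.2
    exact (hQ.1.mem_or_mem (hQ.2 (X_mul_minor_mem (minor_mem_binomialEdgeIdeal h.1)
      (minor_mem_binomialEdgeIdeal h.2) z rfl))).resolve_right fun h => hab' (hQle h)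
  · have hZ : Z.card = 2 * Fintype.card V - 4 := by
      have : Z = (Finset.univ \ {a, b}).disjSum (Finset.univ \ {a, b}) := by
        ext (z | z) <;> simp [Z]
      have h := Finset.card_sdiff_add_card_eq_card (Finset.subset_univ {a, b})
      rw [Finset.card_univ, Finset.card_pair hab] at h
      rw [this, Finset.card_disjSum]
      omega
    rw [← hZ]
    exact card_le_height_cliqueVarIdeal Z

theorem exists_minimalPrime_of_eq_top (hcard : Fintype.card V = 3) :
    ∃ P ∈ (binomialEdgeIdeal K (⊤ : SimpleGraph V)).minimalPrimes,
      ((2 * Fintype.card V - 4 : ℕ) : ℕ∞) ≤ P.height := by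
  obtain ⟨a, b, c, hab, hac, hbc, huniv⟩ := Finset.card_eq_three.1
    (show (Finset.univ : Finset V).card = 3 from hcard)
  have hiso : ∀ f : V → V, IsolatedIn f ∅ := fun f z hz => absurd hz (Finset.notMem_empty z)
  have hmem : ∀ (f : V → V), ∀ z ∈ (∅ : Finset (V ⊕ V)), ∀ v : V, Sum.elim id id z ≠ v :=
    fun f z hz => absurd hz (Finset.notMem_empty z)
  let f : V → V := Function.update id b a
  let I₀ := cliqueVarIdeal K (id : V → V) ∅
  let I₁ := cliqueVarIdeal K f ∅
  let I₂ := cliqueVarIdeal K (fun _ => a) ∅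
  have h₀ : I₀.IsPrime := isPrime_cliqueVarIdeal (hiso _)
  have h₁ : I₁.IsPrime := isPrime_cliqueVarIdeal (hiso _)
  have h₂ : I₂.IsPrime := isPrime_cliqueVarIdeal (hiso _)
  have hlt₀ : I₀ < I₁ := by
    refine ⟨cliqueVarIdeal_le ?_ (by simp), fun h => ?_⟩
    · rintro i _ rfl
      simp
    · exact minor_notMem_cliqueVarIdeal (hiso id) (i := a) (j := b) hab
        (fun z hz => hmem id z hz a) (fun z hz => hmem id z hz b)
        (h (minor_mem_cliqueVarIdeal (by simp [f, hab])))
  have hlt₁ : I₁ < I₂ := by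
    refine ⟨cliqueVarIdeal_le (fun i j _ => minor_mem_cliqueVarIdeal rfl) (by simp), fun h => ?_⟩
    exact minor_notMem_cliqueVarIdeal (hiso f) (i := a) (j := c) (by simp [f, hab, hac, hbc.symm])
      (fun z hz => hmem id z hz a) (fun z hz => hmem id z hz c)
      (h (minor_mem_cliqueVarIdeal rfl))
  have hI₂ : I₂ ≤ binomialEdgeIdeal K ⊤ := by
    refine cliqueVarIdeal_le (fun i j _ => ?_) (by simp)
    by_cases h : i = j
    · simp [h]
    · exact minor_mem_binomialEdgeIdeal h
  refine ⟨I₂, ⟨⟨h₂, binomialEdgeIdeal_le fun i j _ => minor_mem_cliqueVarIdeal rfl⟩,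
    fun Q hQ _ => hI₂.trans hQ.2⟩, ?_⟩
  have h := Ideal.height_add_one_le_of_lt_of_isPrime hlt₀
  have h' := Ideal.height_add_one_le_of_lt_of_isPrime hlt₁
  have h'' : (1 : ℕ∞) ≤ I₁.height := le_trans (by simp) h
  rw [hcard]
  refine le_trans ?_ h'
  calc ((2 * 3 - 4 : ℕ) : ℕ∞) = 1 + 1 := by norm_num
    _ ≤ I₁.height + 1 := add_le_add_left h'' 1

end Height

section ProjDim
open CategoryTheory Abelian

theorem projDim_le_of_pdLE {R M : Type} [CommRing R] [AddCommGroup M] [Module R M] {d : ℕ}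
    (h : PdLE R M d) : projDim R (ModuleCat.of R M) ≤ d := by
  refine sInf_le fun N k hk => ?_
  rw [Nat.cast_lt] at hk
  obtain ⟨p, rfl⟩ := Nat.exists_eq_add_of_lt hk
  rw [subsingleton_ext_iff]
  have : HasProjectiveDimensionLT (ModuleCat.of R M) (d + 1) := h
  exact HasProjectiveDimensionLT.subsingleton _ (d + 1) _ (by omega) N

theorem projective_of_projDim_eq_zero {R M : Type} [CommRing R] [AddCommGroup M] [Module R M]
    (h : projDim R (ModuleCat.of R M) = 0) : Module.Projective R M := by
  have hne : { n : ℕ∞ | ∀ (N : ModuleCat R) (k : ℕ), n < (k : ℕ∞) →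
      Subsingleton
        (((Ext R (ModuleCat R) k).obj (Opposite.op (ModuleCat.of R M))).obj N) }.Nonempty := by
    by_contra hempty
    rw [Set.not_nonempty_iff_eq_empty] at hempty
    simp [projDim, hempty] at h
  have hmem := csInf_mem hne
  rw [show sInf _ = (0 : ℕ∞) from h] at hmem
  rw [IsProjective.iff_projective, projective_iff_subsingleton_ext_one]
  intro N
  exact (subsingleton_ext_iff _ N 0).1 (hmem N 1 (by simp))

theorem eq_bot_of_projective_quotient {R : Type} [CommRing R] [IsDomain R] {I : Ideal R}
    (hI : I ≠ ⊤) [Module.Projective R (R ⧸ I)] : I = ⊥ := by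
  obtain ⟨s, hs⟩ := Module.projective_lifting_property I.mkQ LinearMap.id I.mkQ_surjective
  have hs1 : s 1 ≠ 0 := fun h => by
    have := LinearMap.congr_fun hs 1
    rw [LinearMap.comp_apply, h, map_zero] at this
    have := Ideal.Quotient.nontrivial_iff.2 hI
    exact zero_ne_one ‹(0 : R ⧸ I) = _›
  rw [eq_bot_iff]
  intro j hj
  have : j • s 1 = 0 := by
    rw [← map_smul]
    have : j • (1 : R ⧸ I) = 0 := by
      rw [Algebra.smul_def, mul_one]
      exact Ideal.Quotient.eq_zero_iff_mem.2 hj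
    rw [this, map_zero]
  exact (smul_eq_zero.1 this).resolve_right hs1

end ProjDim

theorem binomialEdgeIdeal_ne_top {K V : Type} [Field K] (G : SimpleGraph V) :
    binomialEdgeIdeal K G ≠ ⊤ := by
  intro h
  have hle : binomialEdgeIdeal K G ≤ RingHom.ker (MvPolynomial.constantCoeff (R := K)) := by
    refine Ideal.span_le.2 ?_
    rintro _ ⟨i, j, -, rfl⟩
    simp [RingHom.mem_ker]
  have : (1 : MvPolynomial (V ⊕ V) K) ∈ RingHom.ker (MvPolynomial.constantCoeff (R := K)) :=
    hle (h ▸ Submodule.mem_top)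
  simp [RingHom.mem_ker] at this

theorem bigHeight_eq_of_forall_le {R : Type} [CommRing R] {I : Ideal R} {d : ℕ∞}
    (hle : ∀ P ∈ I.minimalPrimes, P.height ≤ d) (hex : ∃ P ∈ I.minimalPrimes, d ≤ P.height) :
    bigHeight I = d := by
  apply le_antisymm
  · refine sSup_le ?_
    rintro _ ⟨p, hp, rfl⟩
    rw [← PrimeSpectrum.height_eq_orderHeight]
    exact hle _ hp
  · obtain ⟨P, hP, hd⟩ := hex
    refine le_sSup_of_le ⟨⟨P, hP.1.1⟩, hP, rfl⟩ ?_
    rwa [← PrimeSpectrum.height_eq_orderHeight]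

theorem bigHeight_bot {R : Type} [CommRing R] [IsDomain R] : bigHeight (⊥ : Ideal R) = 0 := by
  have h : (⊥ : Ideal R).minimalPrimes = {⊥} := Ideal.minimalPrimes_eq_subsingleton_self
  exact bigHeight_eq_of_forall_le (by simp [h]) ⟨⊥, by simp [h], by simp⟩

theorem maximal_pd_bigHeight (n : ℕ) (K : Type) [Field K] (G : SimpleGraph (Fin n))
    (hpd : projDim (MvPolynomial (Fin n ⊕ Fin n) K)
        (ModuleCat.of _ (MvPolynomial (Fin n ⊕ Fin n) K ⧸ binomialEdgeIdeal K G))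
      = ((2 * n - 4 : ℕ) : ℕ∞)) :
    bigHeight (binomialEdgeIdeal K G) = ((2 * n - 4 : ℕ) : ℕ∞) := by
  rcases lt_or_ge n 3 with hn | hn
  · have h0 : 2 * n - 4 = 0 := by omega
    rw [h0, Nat.cast_zero] at hpd ⊢
    have := projective_of_projDim_eq_zero hpd
    rw [eq_bot_of_projective_quotient (binomialEdgeIdeal_ne_top G), bigHeight_bot]
  have hcard : 3 ≤ Fintype.card (Fin n) := by simpa using hn
  refine bigHeight_eq_of_forall_le (fun P hP => ?_) ?_
  · simpa using height_le_of_mem_minimalPrimes hcard hP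
  by_cases hJ : IsJoinOn G Finset.univ
  · simpa using exists_minimalPrime_of_isJoinOn (K := K) hJ
  by_cases hc : Fintype.card (Fin n) = 3 ∧ G = ⊤
  · obtain ⟨hc, rfl⟩ := hc
    simpa using exists_minimalPrime_of_eq_top (K := K) hc
  have h := projDim_le_of_pdLE
    (pdLE_binomialEdgeIdeal (K := K) G hcard hJ fun h3 htop => hc ⟨h3, htop⟩)
  rw [hpd, Nat.cast_le, Fintype.card_fin] at h
  omega
end

section
/- Let G = C_n be the cycle on n ≥ 6 vertices. Then the v-number of its binomial edge ideal satisfies v(J_{C_n}) = ⌈2n/3⌉. -/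
open SimpleGraph

/-- The v-number of a homogeneous ideal `I`: the least degree `d` of a homogeneous polynomial
`f` such that `I : f` is an associated prime of `I` (i.e. of `S ⧸ I`). -/
noncomputable def vNumber {K : Type} [Field K] {σ : Type} (I : Ideal (MvPolynomial σ K)) : ℕ :=
  sInf { d : ℕ | ∃ f : MvPolynomial σ K, f.IsHomogeneous d ∧
    ∃ p ∈ associatedPrimes (MvPolynomial σ K) (MvPolynomial σ K ⧸ I),
      Submodule.colon I (Ideal.span {f}) = p }

section BinomialEdgeIdeal

open MvPolynomial

variable {K : Type} [Field K] {V : Type}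

/-- The subgraph of `G` on the same vertex set keeping only the edges inside `W`. -/
def edgesWithin (G : SimpleGraph V) (W : Finset V) : SimpleGraph V where
  Adj i j := G.Adj i j ∧ i ∈ W ∧ j ∈ W
  symm := ⟨fun _ _ h => ⟨h.1.symm, h.2.2, h.2.1⟩⟩
  loopless := ⟨fun _ h => h.1.ne rfl⟩

/-- The binomial `x_i y_j - x_j y_i`. -/
noncomputable def edgeBinomial (K : Type) [Field K] (i j : V) : MvPolynomial (V ⊕ V) K :=
  X (Sum.inl i) * X (Sum.inr j) - X (Sum.inl j) * X (Sum.inr i)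

/-- If `i` and `j` are joined in `G[W]`, then `x_i y_j - x_j y_i` times any monomial which is
divisible by a variable of each vertex of `W \ {i, j}` lies in the binomial edge ideal. -/
lemma edgeBinomial_mul_monomial_mem {G : SimpleGraph V} {W : Finset V} {i j : V}
    (h : (edgesWithin G W).Reachable i j) (e : V ⊕ V →₀ ℕ)
    (he : ∀ k ∈ W, k ≠ i → k ≠ j → 0 < e (Sum.inl k) + e (Sum.inr k)) :
    edgeBinomial K i j * monomial e 1 ∈ binomialEdgeIdeal K G := by
  classical
  obtain ⟨p⟩ := h
  induction p generalizing e with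
  | nil => simp [edgeBinomial]
  | @cons i k j hik p ih =>
    have hmem : edgeBinomial K i k ∈ binomialEdgeIdeal K G :=
      Ideal.subset_span ⟨i, k, hik.1, rfl⟩
    by_cases hkj : k = j
    · subst hkj
      exact Ideal.mul_mem_right _ _ hmem
    have hki : k ≠ i := hik.1.ne.symm
    have key : ∀ (u : V ⊕ V), (u = Sum.inl k ∨ u = Sum.inr k) → 0 < e u →
        ∃ a b : V ⊕ V, (a = Sum.inl i ∨ a = Sum.inr i) ∧
          X u * edgeBinomial K i j =
            X a * edgeBinomial K k j + X b * edgeBinomial K i k := by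
      rintro u (rfl | rfl) -
      · exact ⟨Sum.inl i, Sum.inl j, Or.inl rfl, by simp only [edgeBinomial]; ring⟩
      · exact ⟨Sum.inr i, Sum.inr j, Or.inr rfl, by simp only [edgeBinomial]; ring⟩
    obtain ⟨u, hu, hpos⟩ : ∃ u : V ⊕ V, (u = Sum.inl k ∨ u = Sum.inr k) ∧ 0 < e u := by
      have := he k hik.2.2 hki hkj
      by_cases h0 : 0 < e (Sum.inl k)
      · exact ⟨_, Or.inl rfl, h0⟩
      · exact ⟨_, Or.inr rfl, by omega⟩
    obtain ⟨a, b, ha, hab⟩ := key u hu hpos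
    obtain ⟨e', rfl⟩ : ∃ e', e = Finsupp.single u 1 + e' :=
      exists_add_of_le (Finsupp.single_le_iff.2 hpos)
    have hX : ∀ (v : V ⊕ V), (X v : MvPolynomial (V ⊕ V) K) * monomial e' 1 =
        monomial (Finsupp.single v 1 + e') 1 := fun v => by
      rw [X, monomial_mul, one_mul]
    have : edgeBinomial K i j * monomial (Finsupp.single u 1 + e') 1 =
        edgeBinomial K k j * monomial (Finsupp.single a 1 + e') 1
          + X b * monomial e' 1 * edgeBinomial K i k := by
      rw [← hX, ← hX]
      linear_combination monomial e' 1 * hab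
    rw [this]
    refine Ideal.add_mem _ (ih _ fun l hl hlk hlj => ?_) (Ideal.mul_mem_left _ _ hmem)
    by_cases hli : l = i
    · subst hli
      rcases ha with rfl | rfl <;> simp only [Finsupp.add_apply, Finsupp.single_eq_same] <;> omega
    · have := he l hl hli hlj
      rcases hu with rfl | rfl <;>
        simp [hlk] at this ⊢ <;> omega

/-- Two monomials of the same multidegree, with support containing `W`, and with the same
`x`-degree on each component of `G[W]`, agree modulo the binomial edge ideal. -/
lemma monomial_sub_monomial_mem [Fintype V] [DecidableEq V] {G : SimpleGraph V} {W : Finset V}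
    [DecidableEq (edgesWithin G W).ConnectedComponent] (m m' : V ⊕ V →₀ ℕ)
    (hdeg : ∀ i, m (Sum.inl i) + m (Sum.inr i) = m' (Sum.inl i) + m' (Sum.inr i))
    (hW : ∀ i ∈ W, 0 < m (Sum.inl i) + m (Sum.inr i))
    (hC : ∀ C, ∑ i with (edgesWithin G W).connectedComponentMk i = C, m (Sum.inl i) =
      ∑ i with (edgesWithin G W).connectedComponentMk i = C, m' (Sum.inl i)) :
    monomial m 1 - monomial m' 1 ∈ binomialEdgeIdeal K G := by
  induction hN : ∑ i, (m (Sum.inl i) - m' (Sum.inl i)) using Nat.strong_induction_on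
    generalizing m with
  | _ N ih =>
  by_cases hle : ∀ i, m (Sum.inl i) ≤ m' (Sum.inl i)
  · have heq : ∀ i, m (Sum.inl i) = m' (Sum.inl i) := fun i =>
      (Finset.sum_eq_sum_iff_of_le fun i _ => hle i).1
        (hC ((edgesWithin G W).connectedComponentMk i)) i (by simp)
    have : m = m' := by
      ext (i | i)
      · exact heq i
      · have := heq i
        have := hdeg i
        omega
    simp [this]
  · push Not at hle
    obtain ⟨i, hi⟩ := hle
    obtain ⟨j, hji, hj⟩ : ∃ j, (edgesWithin G W).connectedComponentMk j =
        (edgesWithin G W).connectedComponentMk i ∧ m (Sum.inl j) < m' (Sum.inl j) := by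
      by_contra! hcon
      refine (hC ((edgesWithin G W).connectedComponentMk i)).not_gt
        (Finset.sum_lt_sum (fun j hj => hcon j (by simpa using hj)) ⟨i, by simp, hi⟩)
    have hij : i ≠ j := by rintro rfl; omega
    obtain ⟨e, rfl⟩ : ∃ e, m = Finsupp.single (Sum.inl i) 1 + Finsupp.single (Sum.inr j) 1 + e := by
      refine exists_add_of_le fun u => ?_
      have := hdeg j
      rcases u with u | u
      · by_cases h : i = u
        · subst h; simp; omega
        · simp [h]
      · by_cases h : j = u
        · subst h; simp; omega
        · simp [h]
    set m'' := Finsupp.single (Sum.inl j) 1 + Finsupp.single (Sum.inr i) 1 + e with hm''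
    have h1 : edgeBinomial K i j * monomial e 1 ∈ binomialEdgeIdeal K G := by
      refine edgeBinomial_mul_monomial_mem (SimpleGraph.ConnectedComponent.eq.1 hji.symm) e
        fun k hk hki hkj => ?_
      have := hW k hk
      simpa [Finsupp.single_apply, hki.symm, hkj.symm] using this
    have hx : ∀ k, m'' (Sum.inl k) = (if k = j then 1 else 0) + e (Sum.inl k) := fun k => by
      simp [hm'', Finsupp.single_apply, eq_comm]
    have hy : ∀ k, m'' (Sum.inr k) = (if k = i then 1 else 0) + e (Sum.inr k) := fun k => by
      simp [hm'', Finsupp.single_apply, eq_comm]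
    have hx' : ∀ k, (Finsupp.single (Sum.inl i) 1 + Finsupp.single (Sum.inr j) 1 + e : V ⊕ V →₀ ℕ)
        (Sum.inl k) = (if k = i then 1 else 0) + e (Sum.inl k) := fun k => by
      simp [Finsupp.single_apply, eq_comm]
    have hy' : ∀ k, (Finsupp.single (Sum.inl i) 1 + Finsupp.single (Sum.inr j) 1 + e : V ⊕ V →₀ ℕ)
        (Sum.inr k) = (if k = j then 1 else 0) + e (Sum.inr k) := fun k => by
      simp [Finsupp.single_apply, eq_comm]
    simp only [hx', hy'] at *
    have h2 : monomial m'' 1 - monomial m' 1 ∈ binomialEdgeIdeal K G := by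
      refine ih (∑ k, (m'' (Sum.inl k) - m' (Sum.inl k))) ?_ m'' (fun k => ?_) (fun k hk => ?_)
        (fun C => ?_) rfl
      · rw [← hN]
        refine Finset.sum_lt_sum (fun k _ => ?_) ⟨i, Finset.mem_univ _, ?_⟩
        · rw [hx]
          by_cases hkj : k = j
          · subst hkj
            simp [hij.symm] at hj ⊢
            omega
          · rw [if_neg hkj]
            split_ifs <;> omega
        · rw [hx]
          simp [hij] at hi ⊢
          omega
      · rw [hx, hy, ← hdeg]; ring
      · rw [hx, hy]
        have := hW k hk
        omega
      · rw [← hC]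
        simp only [hx, Finset.sum_add_distrib]
        congr 1
        simp [Finset.sum_ite_eq', hji]
    have h3 : (monomial (Finsupp.single (Sum.inl i) 1 + Finsupp.single (Sum.inr j) 1 + e) 1 :
        MvPolynomial (V ⊕ V) K) - monomial m'' 1 = edgeBinomial K i j * monomial e 1 := by
      simp only [hm'', edgeBinomial, X, sub_mul, monomial_mul, one_mul]
    rw [← sub_add_sub_cancel _ (monomial m'' 1), h3]
    exact Ideal.add_mem _ h1 h2

variable [DecidableEq V] {L : Type}

/-- The substitution `x_i ↦ z_i s_{ℓ i}`, `y_i ↦ z_i t_{ℓ i}` for `i ∈ W`, which sends the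
variables of the vertices outside `W` to zero. -/
noncomputable def labelHom (K : Type) [Field K] (W : Finset V) (ℓ : V → L) :
    MvPolynomial (V ⊕ V) K →ₐ[K] MvPolynomial (V ⊕ L ⊕ L) K :=
  aeval (Sum.elim
    (fun i => if i ∈ W then X (Sum.inl i) * X (Sum.inr (Sum.inl (ℓ i))) else 0)
    (fun i => if i ∈ W then X (Sum.inl i) * X (Sum.inr (Sum.inr (ℓ i))) else 0))

/-- The prime ideal attached to the vertex set `W`: the variables of the vertices outside `W`,
together with all `x_i y_j - x_j y_i` for `i`, `j` in the same component of `G[W]`. -/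
noncomputable def componentIdeal (K : Type) [Field K] (G : SimpleGraph V) (W : Finset V) :
    Ideal (MvPolynomial (V ⊕ V) K) :=
  RingHom.ker (labelHom K W (edgesWithin G W).connectedComponentMk)

/-- The exponent of the image under `labelHom` of a variable. -/
noncomputable def labelExponent (ℓ : V → L) : V ⊕ V → (V ⊕ L ⊕ L →₀ ℕ) :=
  Sum.elim
    (fun i => Finsupp.single (Sum.inl i) 1 + Finsupp.single (Sum.inr (Sum.inl (ℓ i))) 1)
    (fun i => Finsupp.single (Sum.inl i) 1 + Finsupp.single (Sum.inr (Sum.inr (ℓ i))) 1)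

/-- The multigrading by vertices. -/
def vertexWeight : V ⊕ V → (V → ℕ) :=
  Sum.elim (fun i => Pi.single i 1) (fun i => Pi.single i 1)

/-- The multigrading by vertices on the target of `labelHom`. -/
def labelWeight : V ⊕ L ⊕ L → (V → ℕ) :=
  Sum.elim (fun i => Pi.single i 1) (fun _ => 0)

@[simp] lemma labelHom_X_inl (W : Finset V) (ℓ : V → L) (i : V) :
    labelHom K W ℓ (X (Sum.inl i)) =
      if i ∈ W then X (Sum.inl i) * X (Sum.inr (Sum.inl (ℓ i))) else 0 := by
  simp [labelHom]

@[simp] lemma labelHom_X_inr (W : Finset V) (ℓ : V → L) (i : V) :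
    labelHom K W ℓ (X (Sum.inr i)) =
      if i ∈ W then X (Sum.inl i) * X (Sum.inr (Sum.inr (ℓ i))) else 0 := by
  simp [labelHom]

lemma mem_componentIdeal {G : SimpleGraph V} {W : Finset V} {f : MvPolynomial (V ⊕ V) K} :
    f ∈ componentIdeal K G W ↔ labelHom K W (edgesWithin G W).connectedComponentMk f = 0 :=
  RingHom.mem_ker

instance componentIdeal_isPrime (G : SimpleGraph V) (W : Finset V) :
    (componentIdeal K G W).IsPrime :=
  RingHom.ker_isPrime _

lemma edgeBinomial_mem_componentIdeal {G : SimpleGraph V} {W : Finset V} {i j : V}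
    (h : i ∈ W → j ∈ W → (edgesWithin G W).Reachable i j) :
    edgeBinomial K i j ∈ componentIdeal K G W := by
  rw [mem_componentIdeal, edgeBinomial]
  by_cases hi : i ∈ W <;> by_cases hj : j ∈ W <;> simp [hi, hj]
  rw [SimpleGraph.ConnectedComponent.eq.2 (h hi hj)]
  ring

lemma edgeBinomial_mem_componentIdeal_iff {G : SimpleGraph V} {W : Finset V} {i j : V}
    (hi : i ∈ W) (hj : j ∈ W) :
    edgeBinomial K i j ∈ componentIdeal K G W ↔ (edgesWithin G W).Reachable i j := by
  refine ⟨fun h => ?_, fun h => edgeBinomial_mem_componentIdeal fun _ _ => h⟩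
  rw [mem_componentIdeal, edgeBinomial] at h
  by_contra hcon
  have hne : (edgesWithin G W).connectedComponentMk i ≠ (edgesWithin G W).connectedComponentMk j :=
    fun h => hcon (SimpleGraph.ConnectedComponent.eq.1 h)
  classical
  have := congrArg (aeval (R := K) (Sum.elim (fun _ => (1 : K)) (Sum.elim
    (fun C => if C = (edgesWithin G W).connectedComponentMk i then 1 else 0)
    (fun C => if C = (edgesWithin G W).connectedComponentMk j then 1 else 0)))) h
  simp [hi, hj, hne, hne.symm] at this

lemma X_mem_componentIdeal_iff {G : SimpleGraph V} {W : Finset V} {i : V} :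
    X (Sum.inl i) ∈ componentIdeal K G W ↔ i ∉ W := by
  rw [mem_componentIdeal]
  by_cases hi : i ∈ W <;> simp [hi]

lemma binomialEdgeIdeal_le_componentIdeal (G : SimpleGraph V) (W : Finset V) :
    binomialEdgeIdeal K G ≤ componentIdeal K G W := by
  rw [binomialEdgeIdeal, Ideal.span_le]
  rintro f ⟨i, j, hij, rfl⟩
  exact edgeBinomial_mem_componentIdeal fun hi hj =>
    SimpleGraph.Adj.reachable (⟨hij, hi, hj⟩ : (edgesWithin G W).Adj i j)

/-- Labels which are constant along the edges inside `W` are coarser than components. -/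
lemma labelHom_eq_zero_of_mem {G : SimpleGraph V} {W : Finset V} {f : MvPolynomial (V ⊕ V) K}
    (hf : f ∈ componentIdeal K G W) (ℓ : V → L)
    (hℓ : ∀ i j, (edgesWithin G W).Adj i j → ℓ i = ℓ j) : labelHom K W ℓ f = 0 := by
  have hr : ∀ i j, (edgesWithin G W).Reachable i j → ℓ i = ℓ j := by
    rintro i j ⟨p⟩
    induction p with
    | nil => rfl
    | cons h _ ih => exact (hℓ _ _ h).trans ih
  let q : (edgesWithin G W).ConnectedComponent → L :=
    SimpleGraph.ConnectedComponent.lift ℓ fun i j p _ => hr i j p.reachable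
  have : labelHom K W ℓ = (rename (Sum.map id (Sum.map q q))).comp
      (labelHom K W (edgesWithin G W).connectedComponentMk) := by
    ext (i | i) : 1 <;> by_cases hi : i ∈ W <;> simp [hi, q]
  rw [this, AlgHom.comp_apply, mem_componentIdeal.1 hf, map_zero]

/-- `labelHom` depends only on the labels of the vertices which occur. -/
lemma labelHom_congr {W W' : Finset V} {ℓ ℓ' : V → L} {f : MvPolynomial (V ⊕ V) K}
    (h : ∀ i, ∀ m ∈ f.support, m (Sum.inl i) + m (Sum.inr i) ≠ 0 →
      (i ∈ W ↔ i ∈ W') ∧ ℓ i = ℓ' i) : labelHom K W ℓ f = labelHom K W' ℓ' f := by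
  rw [labelHom, labelHom, aeval_def, aeval_def]
  apply eval₂_congr
  intro u m hu hm
  have hm' := mem_support_iff.2 hm
  have hu' := Finsupp.mem_support_iff.1 hu
  rcases u with i | i
  · obtain ⟨h1, h2⟩ := h i m hm' (by omega)
    simp [h1, h2]
  · obtain ⟨h1, h2⟩ := h i m hm' (by omega)
    simp [h1, h2]

lemma labelHom_monomial {W : Finset V} (ℓ : V → L) {m : V ⊕ V →₀ ℕ}
    (hm : ∀ i, m (Sum.inl i) + m (Sum.inr i) ≠ 0 → i ∈ W) (c : K) :
    labelHom K W ℓ (monomial m c) = monomial (Finsupp.weight (labelExponent ℓ) m) c := by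
  rw [labelHom, aeval_monomial, Finsupp.weight_apply, monomial_finsupp_sum_index]
  refine congrArg _ (Finsupp.prod_congr fun u hu => ?_)
  have hu' := Finsupp.mem_support_iff.1 hu
  rcases u with i | i
  · have : i ∈ W := hm i (by omega)
    rw [← one_pow (m (Sum.inl i)), ← monomial_pow]
    simp [this, labelExponent, X, monomial_mul]
  · have : i ∈ W := hm i (by omega)
    rw [← one_pow (m (Sum.inr i)), ← monomial_pow]
    simp [this, labelExponent, X, monomial_mul]

lemma labelHom_monomial_eq_zero {W : Finset V} (ℓ : V → L) {m : V ⊕ V →₀ ℕ} {i : V}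
    (hm : m (Sum.inl i) + m (Sum.inr i) ≠ 0) (hi : i ∉ W) (c : K) :
    labelHom K W ℓ (monomial m c) = 0 := by
  rw [labelHom, aeval_monomial]
  obtain ⟨u, hu, h0⟩ : ∃ u, m u ≠ 0 ∧ (u = Sum.inl i ∨ u = Sum.inr i) := by
    by_cases h : m (Sum.inl i) = 0
    · exact ⟨Sum.inr i, by omega, Or.inr rfl⟩
    · exact ⟨Sum.inl i, h, Or.inl rfl⟩
  rw [Finsupp.prod, Finset.prod_eq_zero (Finsupp.mem_support_iff.2 hu), mul_zero]
  rcases h0 with rfl | rfl <;> simp [hi, hu]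

/-- `labelHom` is compatible with the multigradings. -/
lemma labelHom_weightedHomogeneousComponent (W : Finset V) (ℓ : V → L) (d : V → ℕ)
    (f : MvPolynomial (V ⊕ V) K) :
    labelHom K W ℓ (weightedHomogeneousComponent vertexWeight d f) =
      weightedHomogeneousComponent labelWeight d (labelHom K W ℓ f) := by
  induction f using MvPolynomial.induction_on' with
  | add p q hp hq => simp only [map_add, hp, hq]
  | monomial m c =>
    have h1 : IsWeightedHomogeneous vertexWeight (monomial m c) (Finsupp.weight vertexWeight m) :=
      isWeightedHomogeneous_monomial vertexWeight m c rfl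
    have h2 : IsWeightedHomogeneous labelWeight (labelHom K W ℓ (monomial m c))
        (Finsupp.weight vertexWeight m) := by
      by_cases hm : ∀ i, m (Sum.inl i) + m (Sum.inr i) ≠ 0 → i ∈ W
      · rw [labelHom_monomial ℓ hm]
        refine isWeightedHomogeneous_monomial _ _ _ ?_
        change Finsupp.weight labelWeight (∑ u ∈ m.support, m u • labelExponent ℓ u) =
          ∑ u ∈ m.support, m u • vertexWeight u
        rw [map_sum]
        refine Finset.sum_congr rfl fun u _ => ?_
        rcases u with i | i <;>
          simp [labelExponent, vertexWeight, labelWeight, Finsupp.weight_single]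
      · push Not at hm
        obtain ⟨i, hi, hiW⟩ := hm
        rw [labelHom_monomial_eq_zero ℓ hi hiW]
        exact isWeightedHomogeneous_zero _ _ _
    by_cases hd : Finsupp.weight vertexWeight m = d
    · subst hd
      rw [h1.weightedHomogeneousComponent_same, h2.weightedHomogeneousComponent_same]
    · rw [h1.weightedHomogeneousComponent_ne _ (Ne.symm hd),
        h2.weightedHomogeneousComponent_ne _ (Ne.symm hd),
        map_zero]

lemma weight_vertexWeight [Fintype V] (m : V ⊕ V →₀ ℕ) (i : V) :
    Finsupp.weight vertexWeight m i = m (Sum.inl i) + m (Sum.inr i) := by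
  simp [Finsupp.weight_apply, Finsupp.sum_fintype, vertexWeight, Pi.single_apply]

lemma weight_labelExponent_inl [Fintype V] (ℓ : V → L) (m : V ⊕ V →₀ ℕ) (i : V) :
    Finsupp.weight (labelExponent ℓ) m (Sum.inl i) = m (Sum.inl i) + m (Sum.inr i) := by
  classical
  simp [Finsupp.weight_apply, Finsupp.sum_fintype, labelExponent, Finsupp.single_apply]

lemma weight_labelExponent_inr_inl [Fintype V] [DecidableEq L] (ℓ : V → L)
    (m : V ⊕ V →₀ ℕ) (C : L) :
    Finsupp.weight (labelExponent ℓ) m (Sum.inr (Sum.inl C)) =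
      ∑ i with ℓ i = C, m (Sum.inl i) := by
  simp [Finsupp.weight_apply, Finsupp.sum_fintype, labelExponent,
    Finsupp.single_apply, Finset.sum_filter]

/-- The binomial edge ideal is the intersection of the prime ideals `componentIdeal K G W`. -/
theorem mem_binomialEdgeIdeal_of_forall [Fintype V] {G : SimpleGraph V}
    {f : MvPolynomial (V ⊕ V) K} (hf : ∀ W, f ∈ componentIdeal K G W) : f ∈ binomialEdgeIdeal K G := by
  classical
  induction hN : f.support.card using Nat.strong_induction_on generalizing f with
  | _ N ih =>
  rcases f.support.eq_empty_or_nonempty with h0 | ⟨m, hm⟩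
  · rw [support_eq_empty.1 h0]
    exact zero_mem _
  let W : Finset V := {i | m (Sum.inl i) + m (Sum.inr i) ≠ 0}
  set ℓ := (edgesWithin G W).connectedComponentMk with hℓ
  have hmW : ∀ i, m (Sum.inl i) + m (Sum.inr i) ≠ 0 → i ∈ W := fun i hi => by simpa [W] using hi
  obtain ⟨m', hm', hne, hwt⟩ : ∃ m' ∈ f.support, m' ≠ m ∧
      Finsupp.weight (labelExponent ℓ) m' = Finsupp.weight (labelExponent ℓ) m := by
    by_contra! hcon
    have h1 := congrArg (coeff (Finsupp.weight (labelExponent ℓ) m)) (mem_componentIdeal.1 (hf W))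
    rw [f.as_sum, map_sum, coeff_sum, coeff_zero, Finset.sum_eq_single m, labelHom_monomial _ hmW,
      coeff_monomial, if_pos rfl] at h1
    · exact mem_support_iff.1 hm h1
    · intro m' hm' hne
      by_cases hW : ∀ i, m' (Sum.inl i) + m' (Sum.inr i) ≠ 0 → i ∈ W
      · rw [labelHom_monomial _ hW, coeff_monomial, if_neg (hcon m' hm' hne)]
      · push Not at hW
        obtain ⟨i, hi, hiW⟩ := hW
        rw [labelHom_monomial_eq_zero _ hi hiW, coeff_zero]
    · exact fun h => absurd hm h
  have hsub : monomial m (1 : K) - monomial m' 1 ∈ binomialEdgeIdeal K G := by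
    refine monomial_sub_monomial_mem (W := W) m m' (fun i => ?_) (fun i hi => ?_) (fun C => ?_)
    · rw [← weight_labelExponent_inl ℓ, ← weight_labelExponent_inl ℓ, hwt]
    · have : m (Sum.inl i) + m (Sum.inr i) ≠ 0 := by simpa [W] using hi
      omega
    · have := DFunLike.congr_fun hwt (Sum.inr (Sum.inl C))
      rw [weight_labelExponent_inr_inl, weight_labelExponent_inr_inl] at this
      convert this.symm
  have hsub' : C (coeff m f) * (monomial m (1 : K) - monomial m' 1) ∈ binomialEdgeIdeal K G :=
    Ideal.mul_mem_left _ _ hsub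
  have key := ih (f - C (coeff m f) * (monomial m (1 : K) - monomial m' 1)).support.card ?_
    (fun W' => Ideal.sub_mem _ (hf W') (binomialEdgeIdeal_le_componentIdeal G W' hsub')) rfl
  · simpa using Ideal.add_mem _ key hsub'
  · rw [← hN]
    refine Finset.card_lt_card ((Finset.ssubset_iff_of_subset fun e he => ?_).2 ⟨m, hm, ?_⟩)
    · rw [mem_support_iff] at he ⊢
      intro h
      have h1 : m ≠ e := by rintro rfl; exact mem_support_iff.1 hm h
      have h2 : m' ≠ e := by rintro rfl; exact mem_support_iff.1 hm' h
      simp [h, coeff_C_mul, coeff_monomial, h1, h2] at he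
    · simp [coeff_C_mul, coeff_monomial, hne]

/-- A prime colon ideal `J_G : f` contains some `componentIdeal K G U` with
`f ∉ componentIdeal K G U`, and this ideal is contained in every `componentIdeal K G W` avoiding `f`. -/
lemma exists_componentIdeal_of_colon_isPrime [Fintype V] {G : SimpleGraph V}
    {f : MvPolynomial (V ⊕ V) K}
    (hp : (Submodule.colon (binomialEdgeIdeal K G) (Ideal.span {f} : Set _)).IsPrime) :
    ∃ U, f ∉ componentIdeal K G U ∧
      ∀ W, f ∉ componentIdeal K G W → componentIdeal K G U ≤ componentIdeal K G W := by
  have hcolon : ∀ q, q ∈ Submodule.colon (binomialEdgeIdeal K G) (Ideal.span {f} : Set _) ↔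
      q * f ∈ binomialEdgeIdeal K G := fun q => Ideal.mem_colon_span_singleton
  suffices h : ∃ U, f ∉ componentIdeal K G U ∧
      ∀ q ∈ componentIdeal K G U, q * f ∈ binomialEdgeIdeal K G by
    obtain ⟨U, hfU, hU⟩ := h
    refine ⟨U, hfU, fun W hfW q hq => ?_⟩
    exact ((componentIdeal_isPrime G W).mem_or_mem
      (binomialEdgeIdeal_le_componentIdeal G W (hU q hq))).resolve_right hfW
  by_contra! hcon
  have hq : ∀ U, ∃ q, q * f ∈ componentIdeal K G U ∧ q * f ∉ binomialEdgeIdeal K G := by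
    intro U
    by_cases hfU : f ∈ componentIdeal K G U
    · refine ⟨1, by simpa using hfU, fun h => hp.ne_top ?_⟩
      exact (Ideal.eq_top_iff_one _).2 ((hcolon 1).2 h)
    · obtain ⟨q, hqU, hq⟩ := hcon U hfU
      exact ⟨q, Ideal.mul_mem_right _ _ hqU, hq⟩
  choose q hqU hq using hq
  have hprod : (∏ U, q U) ∈ Submodule.colon (binomialEdgeIdeal K G) (Ideal.span {f} : Set _) := by
    rw [hcolon]
    refine mem_binomialEdgeIdeal_of_forall fun W => ?_
    rw [← Finset.mul_prod_erase _ _ (Finset.mem_univ W), mul_right_comm]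
    exact Ideal.mul_mem_right _ _ (hqU W)
  obtain ⟨U, -, hU⟩ := hp.prod_mem_iff.1 hprod
  exact hq U ((hcolon _).1 hU)

/-- The data of `exists_componentIdeal_of_colon_isPrime`, for some multigraded component. -/
structure IsColonWitness (G : SimpleGraph V) (U : Finset V) (d : V → ℕ)
    (g : MvPolynomial (V ⊕ V) K) : Prop where
  notMem : g ∉ componentIdeal K G U
  degree : ∀ m ∈ g.support, ∀ i, m (Sum.inl i) + m (Sum.inr i) = d i
  le : ∀ W, g ∉ componentIdeal K G W → componentIdeal K G U ≤ componentIdeal K G W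

lemma exists_isColonWitness [Fintype V] {G : SimpleGraph V} {f : MvPolynomial (V ⊕ V) K} {N : ℕ}
    (hf : f.IsHomogeneous N)
    (hp : (Submodule.colon (binomialEdgeIdeal K G) (Ideal.span {f} : Set _)).IsPrime) :
    ∃ U d, ∃ g : MvPolynomial (V ⊕ V) K, IsColonWitness G U d g ∧ ∑ i, d i = N := by
  classical
  obtain ⟨U, hfU, hU⟩ := exists_componentIdeal_of_colon_isPrime hp
  obtain ⟨d, hd⟩ : ∃ d, weightedHomogeneousComponent vertexWeight d f ∉ componentIdeal K G U := by
    by_contra! hcon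
    refine hfU ?_
    rw [← sum_weightedHomogeneousComponent vertexWeight f]
    rw [finsum_eq_sum _ (weightedHomogeneousComponent_finsupp f)]
    exact Ideal.sum_mem _ fun d _ => hcon d
  have hdeg : ∀ m ∈ (weightedHomogeneousComponent vertexWeight d f).support,
      m ∈ f.support ∧ ∀ i, m (Sum.inl i) + m (Sum.inr i) = d i := by
    intro m hm
    rw [support_weightedHomogeneousComponent, Finset.mem_filter] at hm
    exact ⟨hm.1, fun i => by rw [← weight_vertexWeight, hm.2]⟩
  refine ⟨U, d, _, ⟨hd, fun m hm => (hdeg m hm).2, fun W hW => hU W fun h => hW ?_⟩, ?_⟩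
  · rw [mem_componentIdeal] at h ⊢
    rw [labelHom_weightedHomogeneousComponent, h, map_zero]
  · obtain ⟨m, hm⟩ : (weightedHomogeneousComponent vertexWeight d f).support.Nonempty := by
      rw [Finset.nonempty_iff_ne_empty, Ne, support_eq_empty]
      intro h
      exact hd (h ▸ zero_mem _)
    obtain ⟨hmf, hmd⟩ := hdeg m hm
    have := hf (mem_support_iff.1 hmf)
    rw [Finsupp.weight_apply, Finsupp.sum_fintype _ _ (by simp), Fintype.sum_sum_type] at this
    simp only [← hmd, Finset.sum_add_distrib]
    simpa using this

/-- If each monomial of `g` has degree one in the variables of `i`, then `labelHom K U ℓ g` is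
linear in the variables labelled by `ℓ i`. -/
lemma exists_labelHom_update_eq {U : Finset V} (ℓ : V → L) {i : V}
    (g : MvPolynomial (V ⊕ V) K) (hg : ∀ m ∈ g.support, m (Sum.inl i) + m (Sum.inr i) = 1) :
    ∃ A B, ∀ C, labelHom K U (Function.update ℓ i C) g =
      A * X (Sum.inr (Sum.inl C)) + B * X (Sum.inr (Sum.inr C)) := by
  suffices h : ∃ A B, ∀ C, labelHom K U (Function.update ℓ i C)
      (∑ m ∈ g.support, monomial m (coeff m g)) =
        A * X (Sum.inr (Sum.inl C)) + B * X (Sum.inr (Sum.inr C)) by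
    rwa [← g.as_sum] at h
  refine Finset.sum_induction _ (fun g : MvPolynomial (V ⊕ V) K =>
    ∃ A B, ∀ C, labelHom K U (Function.update ℓ i C) g =
      A * X (Sum.inr (Sum.inl C)) + B * X (Sum.inr (Sum.inr C))) ?_ ⟨0, 0, by simp⟩ fun m hm => ?_
  · rintro p q ⟨A, B, h⟩ ⟨A', B', h'⟩
    exact ⟨A + A', B + B', fun C => by rw [map_add, h, h']; ring⟩
  · have h1 := hg m hm
    set c := coeff m g
    by_cases hi : i ∈ U
    swap
    · exact ⟨0, 0, fun C => by
        simp [labelHom_monomial_eq_zero _ (show _ ≠ 0 by rw [h1]; exact one_ne_zero) hi]⟩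
    obtain ⟨u, hu, hmu⟩ : ∃ u, (u = Sum.inl i ∨ u = Sum.inr i) ∧ m u = 1 := by
      by_cases h : m (Sum.inl i) = 0
      · exact ⟨_, Or.inr rfl, by omega⟩
      · exact ⟨_, Or.inl rfl, by omega⟩
    obtain ⟨e, rfl⟩ : ∃ e, m = Finsupp.single u 1 + e :=
      exists_add_of_le (Finsupp.single_le_iff.2 hmu.ge)
    have hmul : monomial (Finsupp.single u 1 + e) c = X u * monomial e c := by
      rw [X, monomial_mul, one_mul]
    have he : e (Sum.inl i) = 0 ∧ e (Sum.inr i) = 0 := by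
      rcases hu with rfl | rfl <;> simp at h1 <;> omega
    have hcongr : ∀ C, labelHom K U (Function.update ℓ i C) (monomial e c) =
        labelHom K U ℓ (monomial e c) := fun C => by
      refine labelHom_congr fun j m hm hj => ⟨Iff.rfl, Function.update_of_ne ?_ _ _⟩
      rintro rfl
      rw [Finset.mem_singleton.1 (support_monomial_subset hm)] at hj
      omega
    rcases hu with rfl | rfl
    · refine ⟨X (Sum.inl i) * labelHom K U ℓ (monomial e c), 0, fun C => ?_⟩
      rw [hmul, map_mul, hcongr]
      simp [hi]
      ring
    · refine ⟨0, X (Sum.inl i) * labelHom K U ℓ (monomial e c), fun C => ?_⟩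
      rw [hmul, map_mul, hcongr]
      simp [hi]
      ring

namespace IsColonWitness

variable {G : SimpleGraph V} {U : Finset V} {d : V → ℕ} {g : MvPolynomial (V ⊕ V) K}

lemma mem_of_degree_ne_zero (h : IsColonWitness G U d g) {i : V} (hi : d i ≠ 0) : i ∈ U := by
  by_contra hiU
  refine h.notMem ?_
  rw [mem_componentIdeal, g.as_sum, map_sum]
  exact Finset.sum_eq_zero fun m hm =>
    labelHom_monomial_eq_zero _ (by rwa [h.degree m hm]) hiU _

lemma mem_of_notMem (h : IsColonWitness G U d g) {W : Finset V} {t : V} (ht : t ∈ W)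
    (htU : t ∉ U) : g ∈ componentIdeal K G W := by
  by_contra hW
  exact X_mem_componentIdeal_iff.1 (h.le W hW (X_mem_componentIdeal_iff.2 htU)) ht

lemma labelHom_eq_zero (h : IsColonWitness G U d g) {W : Finset V} (hW : ∀ i, d i ≠ 0 → i ∈ W)
    (hgW : g ∈ componentIdeal K G W) (ℓ ℓ' : V → L)
    (hℓ : ∀ i j, (edgesWithin G W).Adj i j → ℓ i = ℓ j) (hℓ' : ∀ i, d i ≠ 0 → ℓ i = ℓ' i) :
    labelHom K U ℓ' g = 0 := by
  rw [← labelHom_eq_zero_of_mem hgW ℓ hℓ]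
  refine (labelHom_congr fun i m hm hi => ?_).symm
  rw [h.degree m hm] at hi
  exact ⟨iff_of_true (hW i hi) (h.mem_of_degree_ne_zero hi), hℓ' i hi⟩

/-- A vertex `t ∉ U` cannot be added to `U`, possibly after removing vertices which do not occur
in `g`, in such a way that it becomes a leaf. -/
lemma false_of_leaf (h : IsColonWitness G U d g) {W : Finset V} {t q : V} (htU : t ∉ U)
    (htW : t ∈ W) (hWU : ∀ i ∈ W, i ≠ t → i ∈ U) (hW : ∀ i, d i ≠ 0 → i ∈ W)
    (hq : ∀ j ∈ W, G.Adj t j → j = q) : False := by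
  refine h.notMem (h.labelHom_eq_zero hW (h.mem_of_notMem htW htU)
    (Function.update (edgesWithin G U).connectedComponentMk t
      ((edgesWithin G U).connectedComponentMk q)) _ ?_ fun i hi => Function.update_of_ne ?_ _ _)
  · rintro i j ⟨hij, hi, hj⟩
    by_cases hit : i = t
    · subst hit
      rw [hq j hj hij]
      by_cases hqi : q = i <;> simp [hqi]
    · by_cases hjt : j = t
      · subst hjt
        rw [hq i hi hij.symm]
        by_cases hqj : q = j <;> simp [hqj]
      · rw [Function.update_of_ne hit, Function.update_of_ne hjt]
        exact SimpleGraph.ConnectedComponent.eq.2 (SimpleGraph.Adj.reachable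
          (⟨hij, hWU i hi hit, hWU j hj hjt⟩ : (edgesWithin G U).Adj i j))
  · rintro rfl
    exact htU (h.mem_of_degree_ne_zero hi)

/-- Vertices which do not occur in `g` cannot disconnect vertices joined in `U`. -/
lemma reachable_of_reachable (h : IsColonWitness G U d g) {W : Finset V} (hWU : W ⊆ U)
    (hW : ∀ i, d i ≠ 0 → i ∈ W) {i j : V} (hi : i ∈ W) (hj : j ∈ W)
    (hij : (edgesWithin G U).Reachable i j) : (edgesWithin G W).Reachable i j := by
  have hgW : g ∉ componentIdeal K G W := fun hgW =>
    h.notMem (h.labelHom_eq_zero hW hgW _ _ (fun a b hab =>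
      SimpleGraph.ConnectedComponent.eq.2 (SimpleGraph.Adj.reachable
        (⟨hab.1, hWU hab.2.1, hWU hab.2.2⟩ : (edgesWithin G U).Adj a b))) fun _ _ => rfl)
  exact (edgeBinomial_mem_componentIdeal_iff (K := K) hi hj).1
    (h.le W hgW (edgeBinomial_mem_componentIdeal fun _ _ => hij))

lemma labelHom_update_eq_zero (h : IsColonWitness G U d g) {i t t' q : V} (ht : t ∉ U)
    (ht' : t' ∉ U) (hi : i ∈ U) (hN : ∀ j, G.Adj i j → j = t ∨ j = t')
    (hNt : ∀ j ∈ U, G.Adj t j → j = i ∨ j = q) :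
    labelHom K U (Function.update (edgesWithin G U).connectedComponentMk i
      ((edgesWithin G U).connectedComponentMk q)) g = 0 := by
  have hit : i ≠ t := by rintro rfl; exact ht hi
  set c := (edgesWithin G U).connectedComponentMk with hc
  have hEdge : ∀ a b, (edgesWithin G (insert t U)).Adj a b → a = t →
      Function.update (Function.update c i (c q)) t (c q) a =
        Function.update (Function.update c i (c q)) t (c q) b := by
    rintro a b ⟨hab, ha, hb⟩ rfl
    have hb' : b ∈ U := (Finset.mem_insert.1 hb).resolve_left hab.ne.symm
    rcases hNt b hb' hab with rfl | rfl
    · simp [hit]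
    · simp [Function.update_apply]
  refine h.labelHom_eq_zero (W := insert t U)
    (fun j hj => Finset.mem_insert_of_mem (h.mem_of_degree_ne_zero hj))
    (h.mem_of_notMem (Finset.mem_insert_self t U) ht)
    (Function.update (Function.update c i (c q)) t (c q)) _ (fun a b hab => ?_)
    fun j hj => Function.update_of_ne ?_ _ _
  · by_cases hat : a = t
    · exact hEdge a b hab hat
    by_cases hbt : b = t
    · exact (hEdge b a hab.symm hbt).symm
    obtain ⟨hab, ha, hb⟩ := hab
    have ha' := (Finset.mem_insert.1 ha).resolve_left hat
    have hb' := (Finset.mem_insert.1 hb).resolve_left hbt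
    have hai : a ≠ i := by
      rintro rfl
      rcases hN b hab with rfl | rfl
      exacts [hbt rfl, ht' hb']
    have hbi : b ≠ i := by
      rintro rfl
      rcases hN a hab.symm with rfl | rfl
      exacts [hat rfl, ht' ha']
    simp only [Function.update_of_ne hat, Function.update_of_ne hbt, Function.update_of_ne hai,
      Function.update_of_ne hbi]
    exact SimpleGraph.ConnectedComponent.eq.2 (SimpleGraph.Adj.reachable
      (⟨hab, ha', hb'⟩ : (edgesWithin G U).Adj a b))
  · rintro rfl
    exact ht (h.mem_of_degree_ne_zero hj)

/-- An isolated vertex of `G[U]` whose two neighbours separate it from different components has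
degree different from one. -/
lemma degree_ne_one (h : IsColonWitness G U d g) {i t t' q q' : V} (ht : t ∉ U)
    (ht' : t' ∉ U) (hi : i ∈ U) (hN : ∀ j, G.Adj i j → j = t ∨ j = t')
    (hNt : ∀ j ∈ U, G.Adj t j → j = i ∨ j = q) (hNt' : ∀ j ∈ U, G.Adj t' j → j = i ∨ j = q')
    (hqq' : ¬ (edgesWithin G U).Reachable q q') : d i ≠ 1 := by
  intro hd
  set c := (edgesWithin G U).connectedComponentMk with hc
  have hne : c q ≠ c q' := fun h => hqq' (SimpleGraph.ConnectedComponent.eq.1 h)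
  obtain ⟨A, B, hAB⟩ := exists_labelHom_update_eq (U := U) c g
    (fun m hm => (h.degree m hm i).trans hd)
  have h1 := h.labelHom_update_eq_zero ht ht' hi hN hNt
  have h2 := h.labelHom_update_eq_zero ht' ht hi (fun j hj => (hN j hj).symm) hNt'
  rw [← hc, hAB] at h1 h2
  set D : MvPolynomial (V ⊕ (edgesWithin G U).ConnectedComponent ⊕ _) K :=
    X (Sum.inr (Sum.inl (c q))) * X (Sum.inr (Sum.inr (c q'))) -
      X (Sum.inr (Sum.inl (c q'))) * X (Sum.inr (Sum.inr (c q))) with hD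
  have hD0 : D ≠ 0 := by
    intro h0
    classical
    have := congrArg (aeval (R := K) (Sum.elim (fun _ => (1 : K)) (Sum.elim
      (fun C => if C = c q then 1 else 0) (fun C => if C = c q' then 1 else 0)))) h0
    simp [hD, hne, hne.symm] at this
  have hA : A = 0 := (mul_eq_zero.1 (show D * A = 0 by
    linear_combination X (Sum.inr (Sum.inr (c q'))) * h1 - X (Sum.inr (Sum.inr (c q))) * h2
    )).resolve_left hD0
  have hB : B = 0 := (mul_eq_zero.1 (show D * B = 0 by
    linear_combination X (Sum.inr (Sum.inl (c q))) * h2 - X (Sum.inr (Sum.inl (c q'))) * h1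
    )).resolve_left hD0
  refine h.notMem (mem_componentIdeal.2 ?_)
  have := hAB (c i)
  rw [Function.update_eq_self] at this
  rw [← hc, this, hA, hB, zero_mul, zero_mul, add_zero]

end IsColonWitness

section Cycle

variable {n : ℕ}

lemma val_finRotate (i : Fin n) :
    ((finRotate n i).val = i.val + 1 ∧ i.val + 1 < n) ∨
      ((finRotate n i).val = 0 ∧ i.val + 1 = n) := by
  have := i.isLt
  obtain ⟨m, rfl⟩ : ∃ m, n = m + 1 := ⟨n - 1, by omega⟩
  by_cases h : i = Fin.last m
  · subst h
    simp
  · have := Fin.val_lt_last h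
    rw [coe_finRotate_of_ne_last h]
    omega

lemma val_finRotate_symm (i : Fin n) :
    (((finRotate n).symm i).val + 1 = i.val) ∨
      (i.val = 0 ∧ ((finRotate n).symm i).val + 1 = n) := by
  have := val_finRotate ((finRotate n).symm i)
  rw [Equiv.apply_symm_apply] at this
  omega

lemma cycleGraph_adj_iff (hn : 3 ≤ n) {i j : Fin n} :
    (cycleGraph n).Adj i j ↔ j = finRotate n i ∨ j = (finRotate n).symm i := by
  obtain ⟨m, rfl⟩ : ∃ m, n = m + 2 := ⟨n - 2, by omega⟩
  rw [cycleGraph_adj, Equiv.eq_symm_apply, finRotate_apply, finRotate_apply,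
    sub_eq_iff_eq_add, sub_eq_iff_eq_add, or_comm, add_comm 1, add_comm 1]
  exact or_congr Iff.rfl eq_comm

lemma cycleGraph_adj_finRotate (hn : 3 ≤ n) (i : Fin n) :
    (cycleGraph n).Adj i (finRotate n i) :=
  (cycleGraph_adj_iff hn).2 (Or.inl rfl)

lemma cycleGraph_adj_finRotate_symm (hn : 3 ≤ n) (i : Fin n) :
    (cycleGraph n).Adj ((finRotate n).symm i) i :=
  ((cycleGraph_adj_iff hn).2 (Or.inr rfl)).symm

/-- Removing two vertices `a` and `b` from a cycle separates the two arcs between them. -/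
lemma between_iff_of_reachable (hn : 3 ≤ n) {W : Finset (Fin n)} {a b : Fin n} (ha : a ∉ W)
    (hb : b ∉ W) {i j : Fin n} (hij : (edgesWithin (cycleGraph n) W).Reachable i j) :
    ((a < i ∧ i < b) ∨ (b < i ∧ i < a)) ↔ ((a < j ∧ j < b) ∨ (b < j ∧ j < a)) := by
  obtain ⟨p⟩ := hij
  induction p with
  | nil => rfl
  | @cons i k j h _ ih =>
    rw [← ih]
    obtain ⟨hik, hi, hk⟩ := h
    have hia : i ≠ a := by rintro rfl; exact ha hi
    have hib : i ≠ b := by rintro rfl; exact hb hi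
    have hka : k ≠ a := by rintro rfl; exact ha hk
    have hkb : k ≠ b := by rintro rfl; exact hb hk
    have h1 := val_finRotate i
    have h2 := val_finRotate_symm i
    simp only [Fin.lt_def, ne_eq, Fin.ext_iff] at *
    rcases (cycleGraph_adj_iff hn).1 hik with h | h <;> rw [Fin.ext_iff] at h <;> omega

lemma not_reachable_of_notMem (hn : 4 ≤ n) {W : Finset (Fin n)} {a b : Fin n} (ha : a ∉ W)
    (hb : b ∉ W) (hab : a ≠ b) (h1 : finRotate n a ≠ b) (h2 : (finRotate n).symm a ≠ b) :
    ¬ (edgesWithin (cycleGraph n) W).Reachable ((finRotate n).symm a) (finRotate n a) := by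
  intro h
  have := between_iff_of_reachable (by omega) ha hb h
  have h3 := val_finRotate a
  have h4 := val_finRotate_symm a
  simp only [Fin.lt_def, ne_eq, Fin.ext_iff] at *
  have := a.isLt
  have := b.isLt
  omega

lemma reachable_finRotate (hn : 3 ≤ n) {W : Finset (Fin n)} {i : Fin n} (hi : i ∈ W)
    (h1 : finRotate n i ∈ W) (h2 : (finRotate n).symm i ∈ W) :
    (edgesWithin (cycleGraph n) W).Reachable ((finRotate n).symm i) (finRotate n i) := by
  have h3 : (edgesWithin (cycleGraph n) W).Adj ((finRotate n).symm i) i :=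
    ⟨cycleGraph_adj_finRotate_symm hn i, h2, hi⟩
  have h4 : (edgesWithin (cycleGraph n) W).Adj i (finRotate n i) :=
    ⟨cycleGraph_adj_finRotate hn i, hi, h1⟩
  exact h3.reachable.trans h4.reachable

lemma card_le_sum {U : Finset (Fin n)} {d : Fin n → ℕ} (h : ∀ i ∈ U, d i ≠ 0) :
    U.card ≤ ∑ i, d i :=
  calc U.card = ∑ i ∈ U, 1 := by simp
    _ ≤ ∑ i ∈ U, d i := Finset.sum_le_sum fun i hi => Nat.one_le_iff_ne_zero.2 (h i hi)
    _ ≤ ∑ i, d i := Finset.sum_le_sum_of_subset (Finset.subset_univ U)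

namespace IsColonWitness

variable {U : Finset (Fin n)} {d : Fin n → ℕ} {g : MvPolynomial (Fin n ⊕ Fin n) K}

lemma degree_ne_zero_of_ne_univ (h : IsColonWitness (cycleGraph n) U d g) (hn : 4 ≤ n)
    (hU : U ≠ Finset.univ) {i : Fin n} (hi : i ∈ U) : d i ≠ 0 := by
  intro hd
  have hW : ∀ j, d j ≠ 0 → j ∈ U.erase i := fun j hj =>
    Finset.mem_erase.2 ⟨by rintro rfl; exact hj hd, h.mem_of_degree_ne_zero hj⟩
  have hleaf : ∀ t q, t ∉ U → (∀ j, (cycleGraph n).Adj t j → j = i ∨ j = q) → False := by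
    intro t q ht hq
    refine h.false_of_leaf (W := insert t (U.erase i)) (q := q) ht (Finset.mem_insert_self _ _)
      (fun j hj hjt => Finset.mem_of_mem_erase ((Finset.mem_insert.1 hj).resolve_left hjt))
      (fun j hj => Finset.mem_insert_of_mem (hW j hj)) fun j hj htj => ?_
    refine (hq j htj).resolve_left ?_
    rintro rfl
    rcases Finset.mem_insert.1 hj with rfl | hj
    · exact ht hi
    · exact Finset.notMem_erase _ _ hj
  have h1 : finRotate n i ∈ U := by
    by_contra ht
    refine hleaf _ (finRotate n (finRotate n i)) ht fun j hj => ?_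
    rcases (cycleGraph_adj_iff (by omega)).1 hj with rfl | rfl
    · exact Or.inr rfl
    · exact Or.inl (Equiv.symm_apply_apply _ _)
  have h2 : (finRotate n).symm i ∈ U := by
    by_contra ht
    refine hleaf _ ((finRotate n).symm ((finRotate n).symm i)) ht fun j hj => ?_
    rcases (cycleGraph_adj_iff (by omega)).1 hj with rfl | rfl
    · exact Or.inl (Equiv.apply_symm_apply _ _)
    · exact Or.inr rfl
  obtain ⟨t, ht⟩ : ∃ t, t ∉ U := by
    by_contra! hcon
    exact hU (Finset.eq_univ_iff_forall.2 hcon)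
  have hv1 := val_finRotate i
  have hv2 := val_finRotate_symm i
  refine not_reachable_of_notMem hn (Finset.notMem_erase i U)
    (fun h => ht (Finset.mem_of_mem_erase h)) (by rintro rfl; exact ht hi)
    (by rintro rfl; exact ht h1) (by rintro rfl; exact ht h2)
    (h.reachable_of_reachable (Finset.erase_subset i U) hW
      (Finset.mem_erase.2 ⟨?_, h2⟩) (Finset.mem_erase.2 ⟨?_, h1⟩)
      (reachable_finRotate (by omega) hi h1 h2))
  · rw [Ne, Fin.ext_iff]; omega
  · rw [Ne, Fin.ext_iff]; omega

lemma sub_two_le_sum_of_eq_univ (h : IsColonWitness (cycleGraph n) Finset.univ d g) (hn : 4 ≤ n) :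
    n - 2 ≤ ∑ i, d i := by
  have hadj : ∀ i j, d i = 0 → d j = 0 → i ≠ j →
      finRotate n i = j ∨ (finRotate n).symm i = j := by
    intro i j hi hj hij
    by_contra! hcon
    have hv1 := val_finRotate i
    have hv2 := val_finRotate_symm i
    refine not_reachable_of_notMem (W := (Finset.univ.erase i).erase j) hn (by simp) (by simp) hij
      hcon.1 hcon.2 (h.reachable_of_reachable (Finset.subset_univ _) (fun k hk => ?_)
        ?_ ?_ (reachable_finRotate (by omega) (by simp) (by simp) (by simp)))
    · simp only [Finset.mem_erase, Finset.mem_univ, and_true]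
      exact ⟨by rintro rfl; exact hk hj, by rintro rfl; exact hk hi⟩
    · simp only [Finset.mem_erase, Finset.mem_univ, and_true]
      exact ⟨hcon.2, by rw [Ne, Fin.ext_iff]; omega⟩
    · simp only [Finset.mem_erase, Finset.mem_univ, and_true]
      exact ⟨hcon.1, by rw [Ne, Fin.ext_iff]; omega⟩
  have hcard : (Finset.univ.filter fun i => d i = 0).card ≤ 2 := by
    by_contra! hcon
    obtain ⟨a, b, c, ha, hb, hc, hab, hac, hbc⟩ := Finset.two_lt_card_iff.1 hcon
    simp only [Finset.mem_filter, Finset.mem_univ, true_and] at ha hb hc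
    have h1 := hadj a b ha hb hab
    have h2 := hadj a c ha hc hac
    have h3 := hadj b c hb hc hbc
    have := val_finRotate a
    have := val_finRotate_symm a
    have := val_finRotate b
    have := val_finRotate_symm b
    simp only [ne_eq, Fin.ext_iff] at *
    omega
  have h1 := card_le_sum (U := Finset.univ.filter fun i => ¬ d i = 0) (d := d) (by simp)
  have h2 := Finset.card_filter_add_card_filter_not (s := Finset.univ) fun i => d i = 0
  rw [Finset.card_univ, Fintype.card_fin] at h2
  omega

/-- The lower bound for the degree. -/
lemma two_mul_le_three_mul_sum (h : IsColonWitness (cycleGraph n) U d g) (hn : 6 ≤ n) :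
    2 * n ≤ 3 * ∑ i, d i := by
  by_cases hU : U = Finset.univ
  · subst hU
    have := h.sub_two_le_sum_of_eq_univ (by omega)
    omega
  have hd : ∀ i ∈ U, d i ≠ 0 := fun i hi => h.degree_ne_zero_of_ne_univ (by omega) hU hi
  have hUcard := card_le_sum hd
  have hcompl : U.card + Uᶜ.card = n := by simp
  by_cases hT : Uᶜ.card ≤ 2
  · omega
  have hindep : ∀ t ∉ U, finRotate n t ∈ U := by
    intro t ht
    by_contra hcon
    refine h.false_of_leaf (W := insert t U) (q := (finRotate n).symm t) ht
      (Finset.mem_insert_self _ _) (fun j hj hjt => (Finset.mem_insert.1 hj).resolve_left hjt)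
      (fun j hj => Finset.mem_insert_of_mem (h.mem_of_degree_ne_zero hj)) fun j hj htj => ?_
    refine ((cycleGraph_adj_iff (by omega)).1 htj).resolve_left ?_
    rintro rfl
    exact hcon ((Finset.mem_insert.1 hj).resolve_left htj.ne.symm)
  have hindep' : ∀ t ∉ U, (finRotate n).symm t ∈ U := by
    intro t ht
    by_contra hcon
    have := hindep _ hcon
    rw [Equiv.apply_symm_apply] at this
    exact ht this
  have hle : ∀ i, (if finRotate n i ∉ U then 1 else 0) +
      (if (finRotate n).symm i ∉ U then 1 else 0) ≤ d i := by
    intro i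
    by_cases hi : i ∈ U
    swap
    · rw [if_neg (not_not.2 (hindep i hi)), if_neg (not_not.2 (hindep' i hi))]
      exact Nat.zero_le _
    have h0 := hd i hi
    by_cases h1 : finRotate n i ∈ U
    · simp only [h1, not_true, if_false]
      split_ifs <;> omega
    by_cases h2 : (finRotate n).symm i ∈ U
    · simp only [h2, not_true, if_false]
      split_ifs
      omega
    suffices d i ≠ 1 by
      split_ifs
      omega
    have hq1 := hindep _ h1
    have hq2 := hindep' _ h2
    obtain ⟨t, htU, ht1, ht2⟩ : ∃ t, t ∉ U ∧ t ≠ finRotate n i ∧ t ≠ (finRotate n).symm i := by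
      by_contra! hcon
      refine hT ((Finset.card_le_card (t := {finRotate n i, (finRotate n).symm i})
        fun t ht => ?_).trans Finset.card_le_two)
      rw [Finset.mem_insert, Finset.mem_singleton]
      exact or_iff_not_imp_left.2 fun h => hcon t (Finset.mem_compl.1 ht) h
    refine h.degree_ne_one (t := finRotate n i) (t' := (finRotate n).symm i)
      (q := finRotate n (finRotate n i)) (q' := (finRotate n).symm ((finRotate n).symm i)) h1 h2 hi
      (fun j hj => (cycleGraph_adj_iff (by omega)).1 hj) (fun j _ hj => ?_) (fun j _ hj => ?_)
      fun hcon => ?_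
    · rcases (cycleGraph_adj_iff (by omega)).1 hj with rfl | rfl
      · exact Or.inr rfl
      · exact Or.inl (Equiv.symm_apply_apply _ _)
    · rcases (cycleGraph_adj_iff (by omega)).1 hj with rfl | rfl
      · exact Or.inl (Equiv.apply_symm_apply _ _)
      · exact Or.inr rfl
    · have hb := between_iff_of_reachable (by omega) h1 htU hcon
      have ht3 : t ≠ i := by rintro rfl; exact htU hi
      have ht4 : t ≠ finRotate n (finRotate n i) := by rintro rfl; exact htU hq1
      have ht5 : t ≠ (finRotate n).symm ((finRotate n).symm i) := by rintro rfl; exact htU hq2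
      have hv1 := val_finRotate i
      have hv2 := val_finRotate_symm i
      have hv3 := val_finRotate (finRotate n i)
      have hv4 := val_finRotate_symm ((finRotate n).symm i)
      have := t.isLt
      have := i.isLt
      simp only [Fin.lt_def, ne_eq, Fin.ext_iff] at hb ht1 ht2 ht3 ht4 ht5
      omega
  have hsum := Finset.sum_le_sum fun i (_ : i ∈ Finset.univ) => hle i
  have hUc : ∑ i, (if i ∉ U then 1 else 0) = Uᶜ.card := by
    rw [Finset.card_eq_sum_ones, ← Finset.sum_filter]
    congr 1
    ext i
    simp
  rw [Finset.sum_add_distrib, Equiv.sum_comp (finRotate n) fun i => if i ∉ U then 1 else 0,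
    Equiv.sum_comp (finRotate n).symm fun i => if i ∉ U then 1 else 0, hUc] at hsum
  omega

end IsColonWitness

lemma mem_associatedPrimes_of_colon_eq {R : Type*} [CommRing R] {I p : Ideal R} [hp : p.IsPrime]
    {f : R} (h : Submodule.colon I (Ideal.span {f} : Set R) = p) :
    p ∈ associatedPrimes R (R ⧸ I) := by
  refine ⟨hp, Ideal.Quotient.mk I f, ?_⟩
  have : Submodule.colon (⊥ : Submodule R (R ⧸ I)) {Ideal.Quotient.mk I f} = p := by
    ext q
    rw [Submodule.mem_colon_singleton, ← h, Ideal.mem_colon_span_singleton, Submodule.mem_bot,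
      ← Ideal.Quotient.eq_zero_iff_mem, map_mul]
    rfl
  rw [this, hp.radical]

lemma colon_eq_componentIdeal [Fintype V] {G : SimpleGraph V} {U : Finset V}
    {f : MvPolynomial (V ⊕ V) K} (hf : f ∉ componentIdeal K G U)
    (hU : ∀ W, f ∉ componentIdeal K G W → W = U) :
    Submodule.colon (binomialEdgeIdeal K G) (Ideal.span {f} : Set (MvPolynomial (V ⊕ V) K))
      = componentIdeal K G U := by
  ext q
  rw [Ideal.mem_colon_span_singleton]
  constructor
  · intro h
    exact ((componentIdeal_isPrime G U).mem_or_mem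
      (binomialEdgeIdeal_le_componentIdeal G U h)).resolve_right hf
  · intro h
    refine mem_binomialEdgeIdeal_of_forall fun W => ?_
    by_cases hW : f ∈ componentIdeal K G W
    · exact Ideal.mul_mem_left _ _ hW
    · rw [hU W hW]
      exact Ideal.mul_mem_right _ _ h

/-- Every third vertex of the cycle. -/
def cutVertex (j : Fin (n / 3)) : Fin n :=
  ⟨3 * j, by omega⟩

/-- The vertices of the cycle which are not adjacent to any `cutVertex`. -/
def farVertex (j : Fin (n - 3 * (n / 3))) : Fin n :=
  ⟨3 * (n / 3) - 1 + j, by omega⟩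

/-- A polynomial of degree `⌈2n/3⌉` whose colon ideal is prime. -/
noncomputable def cutPolynomial (K : Type) [Field K] (n : ℕ) : MvPolynomial (Fin n ⊕ Fin n) K :=
  (∏ j : Fin (n / 3), edgeBinomial K ((finRotate n).symm (cutVertex j))
    (finRotate n (cutVertex j))) * ∏ j, X (Sum.inl (farVertex j))

lemma cutPolynomial_isHomogeneous : (cutPolynomial K n).IsHomogeneous ((2 * n + 2) / 3) := by
  have h1 : ∀ i j : Fin n, (edgeBinomial K i j).IsHomogeneous 2 := fun i j =>
    ((isHomogeneous_X K _).mul (isHomogeneous_X K _)).sub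
      ((isHomogeneous_X K _).mul (isHomogeneous_X K _))
  convert (IsHomogeneous.prod Finset.univ _ (fun _ => 2) fun j _ => h1
    ((finRotate n).symm (cutVertex j)) (finRotate n (cutVertex j))).mul
    (IsHomogeneous.prod Finset.univ _ (fun _ => 1) fun j _ =>
      isHomogeneous_X K (Sum.inl (farVertex j))) using 1
  · rfl
  · simp only [Finset.sum_const, Finset.card_univ, Fintype.card_fin, smul_eq_mul]
    omega

lemma cutPolynomial_notMem_iff {W : Finset (Fin n)} :
    cutPolynomial K n ∉ componentIdeal K (cycleGraph n) W ↔
      (∀ j : Fin (n / 3), edgeBinomial K ((finRotate n).symm (cutVertex j))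
        (finRotate n (cutVertex j)) ∉ componentIdeal K (cycleGraph n) W) ∧
      ∀ j, farVertex j ∈ W := by
  simp [cutPolynomial, (componentIdeal_isPrime _ _).mul_mem_iff_mem_or_mem,
    Ideal.IsPrime.prod_mem_iff, X_mem_componentIdeal_iff]

lemma mem_of_edgeBinomial_notMem {G : SimpleGraph V} {W : Finset V} {i j : V}
    (h : edgeBinomial K i j ∉ componentIdeal K G W) :
    i ∈ W ∧ j ∈ W ∧ ¬ (edgesWithin G W).Reachable i j := by
  by_contra hcon
  refine h (edgeBinomial_mem_componentIdeal fun hi hj => ?_)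
  by_contra hr
  exact hcon ⟨hi, hj, hr⟩

lemma exists_colon_cutPolynomial (hn : 6 ≤ n) :
    ∃ U, Submodule.colon (binomialEdgeIdeal K (cycleGraph n)) (Ideal.span {cutPolynomial K n} :
      Set (MvPolynomial (Fin n ⊕ Fin n) K)) = componentIdeal K (cycleGraph n) U := by
  let U : Finset (Fin n) := {i | ¬ (i.val % 3 = 0 ∧ i.val < 3 * (n / 3))}
  have hU : ∀ i, i ∈ U ↔ ¬ (i.val % 3 = 0 ∧ i.val < 3 * (n / 3)) := fun i => by simp [U]
  refine ⟨U, colon_eq_componentIdeal (cutPolynomial_notMem_iff.2 ⟨fun j => ?_, fun j => ?_⟩)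
    fun W hW => ?_⟩
  · have h1 := val_finRotate (cutVertex j)
    have h2 := val_finRotate_symm (cutVertex j)
    have hj : (cutVertex j).val = 3 * j.val := rfl
    have := j.isLt
    obtain ⟨b, hb, hbj⟩ : ∃ b : Fin n, (b.val = 0 ∨ b.val = 3) ∧ b ≠ cutVertex j := by
      by_cases h0 : j.val = 0
      · exact ⟨⟨3, by omega⟩, Or.inr rfl, by rw [Ne, Fin.ext_iff]; dsimp only; omega⟩
      · exact ⟨⟨0, by omega⟩, Or.inl rfl, by rw [Ne, Fin.ext_iff]; dsimp only; omega⟩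
    rw [edgeBinomial_mem_componentIdeal_iff (by rw [hU]; omega) (by rw [hU]; omega)]
    refine not_reachable_of_notMem (b := b) (by omega) ?_ ?_ hbj.symm ?_ ?_
    · rw [hU]; omega
    · rw [hU]; omega
    · rw [Ne, Fin.ext_iff]; omega
    · rw [Ne, Fin.ext_iff]; omega
  · have := j.isLt
    rw [hU]
    simp only [farVertex]
    omega
  · obtain ⟨hcut, hfar⟩ := cutPolynomial_notMem_iff.1 hW
    have hcut' := fun j => mem_of_edgeBinomial_notMem (hcut j)
    ext i
    have := i.isLt
    rw [hU]
    constructor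
    · rintro hi ⟨h1, h2⟩
      have hij : cutVertex (⟨i / 3, by omega⟩ : Fin (n / 3)) = i :=
        Fin.ext (by simp only [cutVertex]; omega)
      have := hcut' ⟨i / 3, by omega⟩
      rw [hij] at this
      exact this.2.2 (reachable_finRotate (by omega) hi this.2.1 this.1)
    · intro hi
      have hnext : ∀ j : Fin (n / 3), i.val = 3 * j.val + 1 → i ∈ W := by
        intro j hj
        convert (hcut' j).2.1
        have := val_finRotate (cutVertex j)
        simp only [cutVertex] at *
        exact Fin.ext (by omega)
      have hprev : ∀ j : Fin (n / 3), (i.val + 1 = 3 * j.val ∨ i.val + 1 = n ∧ j.val = 0) →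
          i ∈ W := by
        intro j hj
        convert (hcut' j).1
        have := val_finRotate_symm (cutVertex j)
        simp only [cutVertex] at *
        exact Fin.ext (by omega)
      by_cases h0 : i.val + 1 = n
      · exact hprev ⟨0, by omega⟩ (Or.inr ⟨h0, rfl⟩)
      by_cases h1 : 3 * (n / 3) - 1 ≤ i.val
      · convert hfar ⟨i - (3 * (n / 3) - 1), by omega⟩
        exact Fin.ext (by simp only [farVertex]; omega)
      by_cases h2 : i.val % 3 = 1
      · exact hnext ⟨i / 3, by omega⟩ (by dsimp only; omega)
      · exact hprev ⟨i / 3 + 1, by omega⟩ (Or.inl (by dsimp only; omega))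

end Cycle

end BinomialEdgeIdeal

theorem cycle_vNumber (n : ℕ) (hn : 6 ≤ n) (K : Type) [Field K] :
    vNumber (binomialEdgeIdeal K (cycleGraph n)) = (2 * n + 2) / 3 := by
  obtain ⟨U, hU⟩ := exists_colon_cutPolynomial (K := K) hn
  have hmem : ∃ f : MvPolynomial (Fin n ⊕ Fin n) K, f.IsHomogeneous ((2 * n + 2) / 3) ∧
      ∃ p ∈ associatedPrimes (MvPolynomial (Fin n ⊕ Fin n) K)
        (MvPolynomial (Fin n ⊕ Fin n) K ⧸ binomialEdgeIdeal K (cycleGraph n)),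
      Submodule.colon (binomialEdgeIdeal K (cycleGraph n)) (Ideal.span {f}) = p :=
    ⟨_, cutPolynomial_isHomogeneous, _, mem_associatedPrimes_of_colon_eq hU, hU⟩
  refine le_antisymm (Nat.sInf_le hmem) (le_csInf ⟨_, hmem⟩ ?_)
  rintro N ⟨f, hf, p, hp, hfp⟩
  obtain ⟨U, d, g, h, rfl⟩ := exists_isColonWitness hf (hfp ▸ hp.isPrime)
  have := h.two_mul_le_three_mul_sum hn
  omega
end
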